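/- arXiv:2408.03919 — 3 statements merged into one kernel-verified Lean document; each statement's English description precedes it below -/
import Mathlib

section
/- Let α > 1 and ρ ∈ (0,1). There exist constants 0 < c_J < 1, 0 < c_λ < 1, Λ > ρ⁻¹, and 0 < c' ≤ C' < ∞, depending only on ρ and α, such that the following holds. Let M ≥ 1, A ≥ 1 and set λ = c_λ·M⁻¹·A⁻¹. Assume: (i) J ⊂ 𝕋 is an interval with ℋ¹(J) ≤ c_J·M⁻¹·A⁻¹; (ii) E ⊂ ℝ² is Ahlfors regular with constant A and μ = ℋ¹|_E; (iii) for some z₀ ∈ E and 0 < r < R there is a set F ⊂ E ∩ B_J(z₀,R), and the ball B₀ := B_J(z₀,r) satisfies μ(B_J(z₀,Λr)) ≤ M·ℋ¹(J)·r and X(z,J,λr,ΛR) ∩ F = ∅ for all z ∈ B_J(z₀,Λr) ∩ E; (iv) there exists x ∈ B₀ ∩ F such that X(x,αJ∖J,ρr,r) ∩ E ≠ ∅. Then there exists an interval I ⊂ ℝ such that π_J^⊥(F) ∩ I = ∅, c'·λ·ℋ¹(J)·r ≤ ℋ¹(I) ≤ C'·λ·ℋ¹(J)·r, and π_J^⊥(B₀)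 ⊂ λ⁻¹Λ·I, where λ⁻¹Λ·I denotes the interval concentric with I of length λ⁻¹Λ·ℋ¹(I). -/
open MeasureTheory Metric Set
open scoped ENNReal NNReal

noncomputable section

abbrev R2 := EuclideanSpace ℝ (Fin 2)

/-- The unit vector in direction `2πθ`. -/
def dir (θ : ℝ) : R2 :=
  (EuclideanSpace.equiv (Fin 2) ℝ).symm ![Real.cos (2 * Real.pi * θ), Real.sin (2 * Real.pi * θ)]

/-- Orthogonal projection `π_θ`. -/
def proj (θ : ℝ) (x : R2) : ℝ :=
  x 0 * Real.cos (2 * Real.pi * θ) + x 1 * Real.sin (2 * Real.pi * θ)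

/-- `π_θ^⊥ = π_{θ+1/4}`. -/
def projPerp (θ : ℝ) (x : R2) : ℝ := proj (θ + 1/4) x

/-- Favard length. -/
def Fav (E : Set R2) : ℝ≥0∞ := ∫⁻ θ in Set.Icc (0:ℝ) 1, μH[1] (proj θ '' E)

/-- Ahlfors regularity with constant `A`. -/
def AhlforsRegular (A : ℝ) (E : Set R2) : Prop :=
  IsClosed E ∧ ∀ x ∈ E, ∀ r : ℝ, 0 < r → ENNReal.ofReal r < EMetric.diam E →
    ENNReal.ofReal (A⁻¹ * r) ≤ μH[1] (E ∩ ball x r) ∧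
      μH[1] (E ∩ ball x r) ≤ ENNReal.ofReal (A * r)

/-- A Lipschitz graph with constant `L`: rotated graph of an `L`-Lipschitz function. -/
def IsLipschitzGraph (L : ℝ) (Γ : Set R2) : Prop :=
  ∃ (R : R2 ≃ₗᵢ[ℝ] R2) (f : ℝ → ℝ), LipschitzWith (Real.toNNReal L) f ∧
    Γ = R '' {x : R2 | x 1 = f (x 0)}

/-- The (untruncated) cone `X(x,G)`. -/
def cone (x : R2) (G : Set ℝ) : Set R2 := ⋃ θ ∈ G, {y | ∃ t : ℝ, y = x + t • dir θ}

/-- The truncated cone `X(x,G,r)`. -/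
def coneT (x : R2) (G : Set ℝ) (r : ℝ) : Set R2 := cone x G ∩ ball x r

/-- The doubly truncated cone `X(x,G,r,R)`. -/
def coneA (x : R2) (G : Set ℝ) (r R : ℝ) : Set R2 := coneT x G R \ ball x r

/-- Hardy–Littlewood maximal function of a measure on `ℝ`. -/
def maximalFn (ν : Measure ℝ) (t : ℝ) : ℝ≥0∞ :=
  ⨆ (r : ℝ) (_ : 0 < r), ν (Set.Ioo (t - r) (t + r)) / ENNReal.ofReal (2 * r)

/-- `μ_θ(x) = M(π_θ μ)(π_θ x)`. -/
def projMax (μ : Measure R2) (θ : ℝ) (x : R2) : ℝ≥0∞ :=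
  maximalFn (μ.map (proj θ)) (proj θ x)

/-- `μ_θ^⊥(x) = M(π_θ^⊥ μ)(π_θ^⊥ x)`. -/
def projMaxPerp (μ : Measure R2) (θ : ℝ) (x : R2) : ℝ≥0∞ :=
  maximalFn (μ.map (projPerp θ)) (projPerp θ x)

/-- The interval with center `c` and length `ℓ`. -/
def itv (c ℓ : ℝ) : Set ℝ := Set.Icc (c - ℓ/2) (c + ℓ/2)

/-- The metric `d_I` associated to the interval with center `c` and length `ℓ`. -/
def dmet (c ℓ : ℝ) (x y : R2) : ℝ :=
  Real.sqrt ((ℓ^2)⁻¹ * (projPerp c x - projPerp c y)^2 + (proj c x - proj c y)^2)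

/-- The open `d_I`-ball `B_I(x,r)`. -/
def bmet (c ℓ : ℝ) (x : R2) (r : ℝ) : Set R2 := {y | dmet c ℓ x y < r}

/-- Triadic intervals of `[0,1)`. -/
def IsTriadic (I : Set ℝ) : Prop :=
  ∃ (j k : ℕ), k < 3^j ∧ I = Set.Ico ((k : ℝ)/3^j) ((k+1 : ℝ)/3^j)

/-- 1-dimensional Hausdorff content. -/
def hContent {X : Type*} [EMetricSpace X] (s : Set X) : ℝ≥0∞ :=
  ⨅ (t : ℕ → Set X) (_ : s ⊆ ⋃ n, t n), ∑' n, EMetric.diam (t n)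

/-- `E` is a finite union of parallel segments. -/
def FinUnionParallelSegments (E : Set R2) : Prop :=
  ∃ (n : ℕ) (d : R2) (p q : Fin n → R2), d ≠ 0 ∧
    (∀ i, ∃ t : ℝ, q i - p i = t • d) ∧ E = ⋃ i, segment ℝ (p i) (q i)

theorem projPerp_eq (c : ℝ) (x : R2) :
    projPerp c x = x 1 * Real.cos (2 * Real.pi * c) - x 0 * Real.sin (2 * Real.pi * c) := by
  have h : 2 * Real.pi * (c + 1 / 4) = 2 * Real.pi * c + Real.pi / 2 := by ring
  rw [projPerp, proj, h, Real.cos_add_pi_div_two, Real.sin_add_pi_div_two]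
  ring

theorem dist_sq_eq_proj (c : ℝ) (p q : R2) :
    dist p q ^ 2 = (proj c p - proj c q) ^ 2 + (projPerp c p - projPerp c q) ^ 2 := by
  rw [projPerp_eq, projPerp_eq, EuclideanSpace.dist_eq, Real.sq_sqrt (by positivity),
    Fin.sum_univ_two, Real.dist_eq, Real.dist_eq, sq_abs, sq_abs, proj, proj]
  linear_combination (-(p 0 - q 0) ^ 2 - (p 1 - q 1) ^ 2) *
    Real.sin_sq_add_cos_sq (2 * Real.pi * c)

theorem dir_apply_zero (θ : ℝ) : dir θ 0 = Real.cos (2 * Real.pi * θ) := rfl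

theorem dir_apply_one (θ : ℝ) : dir θ 1 = Real.sin (2 * Real.pi * θ) := rfl

theorem proj_add_smul_dir (c θ t : ℝ) (x : R2) :
    proj c (x + t • dir θ) = proj c x + t * Real.cos (2 * Real.pi * (θ - c)) := by
  rw [mul_sub, Real.cos_sub]
  simp only [proj, PiLp.add_apply, PiLp.smul_apply, smul_eq_mul, dir_apply_zero, dir_apply_one]
  ring

theorem projPerp_add_smul_dir (c θ t : ℝ) (x : R2) :
    projPerp c (x + t • dir θ) = projPerp c x + t * Real.sin (2 * Real.pi * (θ - c)) := by
  rw [mul_sub, Real.sin_sub, projPerp_eq, projPerp_eq]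
  simp only [PiLp.add_apply, PiLp.smul_apply, smul_eq_mul, dir_apply_zero, dir_apply_one]
  ring

theorem eq_of_proj_eq {c : ℝ} {p q : R2} (h : proj c p = proj c q)
    (h' : projPerp c p = projPerp c q) : p = q := by
  have := dist_sq_eq_proj c p q
  rw [h, h', sub_self, sub_self] at this
  exact dist_eq_zero.1 (by simpa using this)

theorem abs_arctan_le (x : ℝ) : |Real.arctan x| ≤ |x| := by
  have key : ∀ y : ℝ, 0 ≤ y → Real.arctan y ≤ y := fun y hy => by
    simpa [Real.tan_arctan] using
      Real.le_tan (Real.arctan_nonneg.2 hy) (Real.arctan_lt_pi_div_two y)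
  rcases le_total 0 x with hx | hx
  · rw [abs_of_nonneg hx, abs_of_nonneg (Real.arctan_nonneg.2 hx)]
    exact key x hx
  · rw [abs_of_nonpos hx, abs_of_nonpos (Real.arctan_le_zero.2 hx), ← Real.arctan_neg]
    exact key _ (by linarith)

theorem mem_cone_of_abs_le {c ℓ : ℝ} (hℓ : 0 ≤ ℓ) {z p : R2}
    (h : |projPerp c p - projPerp c z| ≤ 3 * ℓ * |proj c p - proj c z|) :
    p ∈ cone z (itv c ℓ) := by
  set a := proj c p - proj c z with ha
  set b := projPerp c p - projPerp c z with hb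
  have hb' : a * (b / a) = b := by
    rcases eq_or_ne a 0 with h0 | h0
    · rw [h0, abs_zero, mul_zero] at h
      rw [abs_nonpos_iff.1 h]; simp
    · field_simp
  have hπ := Real.pi_pos
  set φ := Real.arctan (b / a) with hφ
  have hcos : Real.cos φ ≠ 0 := (Real.cos_arctan_pos _).ne'
  have htan : Real.sin φ / Real.cos φ = b / a := by
    rw [← Real.tan_eq_sin_div_cos, hφ, Real.tan_arctan]
  have hangle : 2 * Real.pi * (c + φ / (2 * Real.pi) - c) = φ := by
    field_simp
    ring
  refine mem_iUnion₂.2 ⟨c + φ / (2 * Real.pi), ?_, a / Real.cos φ, ?_⟩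
  · have hba : |b / a| ≤ 3 * ℓ := by
      rw [abs_div]
      exact div_le_of_le_mul₀ (abs_nonneg _) (by positivity) h
    have hφle : |φ| ≤ Real.pi * ℓ := by
      nlinarith [Real.pi_gt_three, abs_arctan_le (b / a)]
    have hdiv : |φ / (2 * Real.pi)| ≤ ℓ / 2 := by
      rw [abs_div, abs_of_pos (by positivity : 0 < 2 * Real.pi), div_le_iff₀ (by positivity)]
      linarith
    obtain ⟨h1, h2⟩ := abs_le.1 hdiv
    exact ⟨by linarith, by linarith⟩
  · apply eq_of_proj_eq (c := c)
    · rw [proj_add_smul_dir, hangle, div_mul_cancel₀ _ hcos]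
      linarith
    · rw [projPerp_add_smul_dir, hangle, div_mul_eq_mul_div, mul_div_assoc, htan, hb']
      linarith

/-- A measure with many disjoint balls of mass at least `m` has large total mass. -/
theorem card_mul_le_measure_of_separated {X : Type*} [PseudoMetricSpace X] [MeasurableSpace X]
    [OpensMeasurableSpace X] (μ : Measure X) {E B : Set X} (hE : MeasurableSet E) {n : ℕ} {ε : ℝ}
    {m : ℝ≥0∞} (p : Fin n → X) (hsep : ∀ i j, i ≠ j → 2 * ε ≤ dist (p i) (p j))
    (hball : ∀ i, ball (p i) ε ⊆ B) (hm : ∀ i, m ≤ μ (E ∩ ball (p i) ε)) :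
    n * m ≤ μ (B ∩ E) := by
  have hdisj : Pairwise (Function.onFun Disjoint fun i => E ∩ ball (p i) ε) := fun i j hij =>
    (ball_disjoint_ball (by linarith [hsep i j hij])).mono inter_subset_right inter_subset_right
  calc (n : ℝ≥0∞) * m = ∑ _i : Fin n, m := by simp
    _ ≤ ∑ i : Fin n, μ (E ∩ ball (p i) ε) := Finset.sum_le_sum fun i _ => hm i
    _ = μ (⋃ i, E ∩ ball (p i) ε) := by
        rw [measure_iUnion hdisj fun i => hE.inter measurableSet_ball, tsum_fintype]
    _ ≤ μ (B ∩ E) := measure_mono <| iUnion_subset fun i =>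
        fun _ hx => ⟨hball i hx.2, hx.1⟩

/-- If `E` has little mass in `B`, then one of the windows
`[U x + (2i+1)δ, U x + (2i+2)δ]` contains no value of `U` on the part of `F` in the strip. -/
theorem exists_empty_window {E F B : Set R2} (hE : MeasurableSet E) (hFE : F ⊆ E) (U V : R2 → ℝ)
    (hUd : ∀ p q, |U p - U q| ≤ dist p q) (hVd : ∀ p q, |V p - V q| ≤ dist p q)
    {x : R2} {δ ε r h w a T : ℝ} {n : ℕ} (hδ : 0 < δ) (hεδ : ε ≤ δ / 2)
    (hεr : ε ≤ r) (hεh : ε ≤ w) (hn : 2 * n * δ ≤ r)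
    (hB : ∀ q, |U q - U x| ≤ 2 * r → |V q - V x| ≤ h + w → q ∈ B)
    (hreg : ∀ p ∈ E, ENNReal.ofReal a ≤ μH[1] (E ∩ ball p ε))
    (hmass : μH[1] (B ∩ E) ≤ ENNReal.ofReal T) (hT : 0 ≤ T) (hlt : T < n * a) :
    ∃ i < n, ∀ p ∈ F, V x ≤ V p → V p ≤ V x + h →
      U p < U x + (2 * i + 1) * δ ∨ U x + (2 * i + 2) * δ < U p := by
  by_contra! hcon
  choose p hpF hp1 hp2 hp3 hp4 using fun i : Fin n => hcon i i.2
  have hsep : ∀ i j : Fin n, i < j → 2 * ε ≤ U (p j) - U (p i) := fun i j hij => by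
    have h1 : ((i : ℕ) : ℝ) + 1 ≤ (j : ℕ) := by exact_mod_cast hij
    nlinarith [hp3 j, hp4 i]
  have key : (n : ℝ≥0∞) * ENNReal.ofReal a ≤ μH[1] (B ∩ E) := by
    refine card_mul_le_measure_of_separated (μH[1]) hE p (fun i j hij => ?_) (fun i q hq => ?_)
      fun i => hreg _ (hFE (hpF i))
    · rcases lt_or_gt_of_ne hij with hlt | hlt
      · rw [dist_comm]
        exact (hsep i j hlt).trans ((le_abs_self _).trans (hUd _ _))
      · exact (hsep j i hlt).trans ((le_abs_self _).trans (hUd _ _))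
    · have hin : ((i : ℕ) : ℝ) + 1 ≤ n := by exact_mod_cast i.2
      have h0 : (0 : ℝ) ≤ (i : ℕ) := Nat.cast_nonneg _
      rw [mem_ball] at hq
      obtain ⟨h1, h2⟩ := abs_le.1 ((hUd q (p i)).trans hq.le)
      obtain ⟨h3, h4⟩ := abs_le.1 ((hVd q (p i)).trans hq.le)
      have := hp1 i
      have := hp2 i
      refine hB q (abs_le.2 ⟨?_, ?_⟩) (abs_le.2 ⟨by linarith, by linarith⟩) <;>
        nlinarith [hp3 i, hp4 i]
  rw [← ENNReal.ofReal_natCast, ← ENNReal.ofReal_mul (Nat.cast_nonneg _)] at key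
  exact hlt.not_ge ((ENNReal.ofReal_le_ofReal_iff hT).1 (key.trans hmass))

/-- An empty window in the `U`-direction yields a gap in the `V`-direction, provided the points of
`F` avoid the flat cones with vertices in `E`. -/
theorem exists_gap_of_empty_window {E F : Set R2} (hFE : F ⊆ E) (U V : R2 → ℝ)
    (hUd : ∀ p q, |U p - U q| ≤ dist p q) {x y : R2} {δ ℓ H K w : ℝ} (hδ : 0 < δ)
    (hℓ : 0 < ℓ) (hxF : x ∈ F) (hyE : y ∈ E) (hxw : U x + δ ≤ w) (hwy : w + δ ≤ U y)
    (hVxy : V x ≤ V y) (hVy : V y ≤ V x + H * ℓ) (hyK : U y ≤ U x + K)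
    (hHK : H ≤ 3 * K)
    (hcone : ∀ z ∈ E, ∀ p ∈ F, |U z - U x| ≤ K → |V z - V x| ≤ H * ℓ → δ ≤ dist z p →
      3 * ℓ * |U p - U z| < |V p - V z|)
    (hwin : ∀ p ∈ F, V x ≤ V p → V p ≤ V x + H * ℓ → U p < w ∨ w + δ < U p) :
    ∃ m, V x ≤ m ∧ m ≤ V y ∧ ∀ p ∈ F, V p < m - 2 * (ℓ * δ) ∨ m - ℓ * δ < V p := by
  have hloc : ∀ p ∈ F, V x ≤ V p → V p ≤ V x + H * ℓ → |U p - U x| ≤ K := by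
    intro p hp h1 h2
    rcases lt_or_ge (dist x p) δ with hd | hd
    · rw [dist_comm] at hd
      linarith [hUd p x]
    · have h3 := hcone x (hFE hxF) p hp (by simp; linarith)
        (by simp; linarith) hd
      rw [abs_of_nonneg (by linarith : 0 ≤ V p - V x)] at h3
      by_contra! hK
      nlinarith
  set S : Set R2 := {z | z ∈ E ∧ w + δ ≤ U z ∧ |U z - U x| ≤ K ∧ V x ≤ V z ∧ V z ≤ V x + H * ℓ}
    with hS
  have hyS : y ∈ S := ⟨hyE, hwy, abs_le.2 ⟨by linarith, by linarith⟩, hVxy, hVy⟩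
  have hsep : ∀ z ∈ S, ∀ p ∈ F, U p ≤ w → 3 * (ℓ * δ) < |V p - V z| := by
    rintro z ⟨hzE, hz1, hz2, hz3, hz4⟩ p hp hpw
    have h1 : δ ≤ |U p - U z| := by
      rw [abs_sub_comm]
      exact le_trans (by linarith) (le_abs_self _)
    have h2 := hcone z hzE p hp hz2 (abs_le.2 ⟨by linarith, by linarith⟩)
      (by rw [dist_comm]; exact h1.trans (hUd p z))
    nlinarith
  have hlow : ∀ z ∈ S, V x + 3 * (ℓ * δ) ≤ V z := by
    intro z hz
    have h1 := hsep z hz x hxF (by linarith)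
    rw [abs_sub_comm, abs_of_nonneg (by linarith [hz.2.2.2.1])] at h1
    linarith
  have hne : (V '' S).Nonempty := ⟨_, mem_image_of_mem V hyS⟩
  have hbdd : BddBelow (V '' S) := ⟨V x + 3 * (ℓ * δ), forall_mem_image.2 hlow⟩
  have hℓδ : 0 < ℓ * δ := by positivity
  have hmlow : V x + 3 * (ℓ * δ) ≤ sInf (V '' S) := le_csInf hne (forall_mem_image.2 hlow)
  have hmy : sInf (V '' S) ≤ V y := csInf_le hbdd (mem_image_of_mem V hyS)
  refine ⟨sInf (V '' S), by linarith, hmy, fun p hp => ?_⟩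
  by_contra! hcon
  obtain ⟨hp1, hp2⟩ := hcon
  have hpx : V x ≤ V p := by linarith
  have hpy : V p ≤ V x + H * ℓ := by linarith
  rcases hwin p hp hpx hpy with hU | hU
  · obtain ⟨_, ⟨z, hz, rfl⟩, hzlt⟩ :=
      exists_lt_of_csInf_lt hne (by linarith : sInf (V '' S) < sInf (V '' S) + ℓ * δ)
    have h1 : sInf (V '' S) ≤ V z := csInf_le hbdd (mem_image_of_mem V hz)
    have h2 := hsep z hz p hp hU.le
    rw [abs_sub_comm, abs_of_nonneg (by linarith)] at h2
    linarith
  · have := csInf_le hbdd (mem_image_of_mem V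
      (⟨hFE hp, hU.le, hloc p hp hpx hpy, hpx, hpy⟩ : p ∈ S))
    linarith

theorem mem_bmet_of_le {c ℓ R a b : ℝ} {z q : R2} (hℓ : 0 < ℓ)
    (hu : |proj c q - proj c z| ≤ a) (hv : |projPerp c q - projPerp c z| ≤ b * ℓ)
    (hab : a + b < R) : q ∈ bmet c ℓ z R := by
  have ha : 0 ≤ a := (abs_nonneg _).trans hu
  have hb : 0 ≤ b := nonneg_of_mul_nonneg_left ((abs_nonneg _).trans hv) hℓ
  refine lt_of_le_of_lt (Real.sqrt_le_iff.2 ⟨add_nonneg ha hb, ?_⟩) hab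
  have h1 : (proj c z - proj c q) ^ 2 ≤ a ^ 2 := by
    rw [← sq_abs, abs_sub_comm]; gcongr
  have h2 : (projPerp c z - projPerp c q) ^ 2 ≤ (b * ℓ) ^ 2 := by
    rw [← sq_abs, abs_sub_comm]; gcongr
  have h3 : (ℓ ^ 2)⁻¹ * (projPerp c z - projPerp c q) ^ 2 ≤ b ^ 2 := by
    rw [inv_mul_le_iff₀ (by positivity)]; linarith [mul_pow b ℓ 2]
  nlinarith [mul_nonneg ha hb]

theorem abs_proj_sub_lt_of_mem_bmet {c ℓ R : ℝ} {z q : R2} (h : q ∈ bmet c ℓ z R) :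
    |proj c q - proj c z| < R := by
  refine lt_of_le_of_lt (Real.abs_le_sqrt ?_) h
  have : 0 ≤ (ℓ ^ 2)⁻¹ * (projPerp c z - projPerp c q) ^ 2 := by positivity
  nlinarith

theorem abs_projPerp_sub_lt_of_mem_bmet {c ℓ R : ℝ} {z q : R2} (hℓ : 0 < ℓ)
    (h : q ∈ bmet c ℓ z R) : |projPerp c q - projPerp c z| < R * ℓ := by
  rw [← div_lt_iff₀ hℓ, ← abs_of_pos hℓ, ← abs_div]
  refine lt_of_le_of_lt (Real.abs_le_sqrt ?_) h
  have : ((projPerp c q - projPerp c z) / ℓ) ^ 2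
      = (ℓ ^ 2)⁻¹ * (projPerp c z - projPerp c q) ^ 2 := by
    field_simp; ring
  nlinarith [sq_nonneg (proj c z - proj c q)]

theorem dist_le_of_abs_le {c a b : ℝ} {z q : R2} (hu : |proj c q - proj c z| ≤ a)
    (hv : |projPerp c q - projPerp c z| ≤ b) : dist q z ≤ a + b := by
  have ha : 0 ≤ a := (abs_nonneg _).trans hu
  have hb : 0 ≤ b := (abs_nonneg _).trans hv
  refine le_of_sq_le_sq ?_ (add_nonneg ha hb)
  rw [dist_sq_eq_proj c, ← sq_abs, ← sq_abs (projPerp c q - _)]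
  nlinarith [mul_nonneg ha hb, pow_le_pow_left₀ (abs_nonneg _) hu 2,
    pow_le_pow_left₀ (abs_nonneg _) hv 2]

theorem dist_lt_of_mem_bmet {c ℓ R : ℝ} {z q : R2} (hℓ : 0 < ℓ) (hℓ1 : ℓ ≤ 1)
    (h : q ∈ bmet c ℓ z R) : dist z q < R := by
  refine lt_of_le_of_lt (Real.le_sqrt_of_sq_le ?_) h
  rw [dist_sq_eq_proj c]
  have h1 : 1 ≤ (ℓ ^ 2)⁻¹ := (one_le_inv₀ (by positivity)).2 (pow_le_one₀ hℓ.le hℓ1)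
  nlinarith [sq_nonneg (projPerp c z - projPerp c q)]

theorem abs_proj_sub_le_dist (c : ℝ) (p q : R2) : |proj c p - proj c q| ≤ dist p q := by
  refine abs_le_of_sq_le_sq ?_ dist_nonneg
  nlinarith [dist_sq_eq_proj c p q, sq_nonneg (projPerp c p - projPerp c q)]

theorem abs_projPerp_sub_le_dist (c : ℝ) (p q : R2) :
    |projPerp c p - projPerp c q| ≤ dist p q :=
  abs_proj_sub_le_dist (c + 1 / 4) p q

theorem dist_add_smul_dir (x : R2) (t θ : ℝ) : dist (x + t • dir θ) x = |t| := by
  refine (sq_eq_sq₀ dist_nonneg (abs_nonneg t)).1 ?_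
  rw [dist_sq_eq_proj θ, proj_add_smul_dir, projPerp_add_smul_dir, sq_abs]
  simp

/-- Coordinate estimates for a point of a narrow annular cone. -/
theorem proj_bounds_of_mem_coneA {c L ρ₀ r : ℝ} {x y : R2} (hL : L ≤ 1 / 4)
    (h : y ∈ coneA x (itv c L) ρ₀ r) :
    ρ₀ / 2 ≤ |proj c y - proj c x| ∧ |projPerp c y - projPerp c x| ≤ 4 * L * r ∧
      ρ₀ ≤ dist x y ∧ dist x y < r := by
  obtain ⟨⟨hcone, hr⟩, hρ⟩ := h
  obtain ⟨θ, ⟨hθ1, hθ2⟩, t, rfl⟩ := mem_iUnion₂.1 hcone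
  rw [mem_ball, dist_add_smul_dir] at hr hρ
  rw [dist_comm, dist_add_smul_dir, proj_add_smul_dir, projPerp_add_smul_dir,
    add_sub_cancel_left, add_sub_cancel_left, abs_mul, abs_mul]
  have hφ : |2 * Real.pi * (θ - c)| ≤ Real.pi * L := by
    have : |θ - c| ≤ L / 2 := abs_le.2 ⟨by linarith, by linarith⟩
    rw [abs_mul, abs_of_pos (by positivity)]
    nlinarith [Real.pi_pos]
  have hL0 : 0 ≤ L := by linarith
  have hπ4 : Real.pi * L ≤ 1 := by nlinarith [Real.pi_le_four, Real.pi_pos]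
  have hcos : 1 / 2 ≤ |Real.cos (2 * Real.pi * (θ - c))| := by
    have h1 := Real.one_sub_sq_div_two_le_cos (x := 2 * Real.pi * (θ - c))
    have h2 : (2 * Real.pi * (θ - c)) ^ 2 ≤ 1 := (sq_le_one_iff_abs_le_one _).2 (hφ.trans hπ4)
    exact le_trans (by linarith) (le_abs_self _)
  have hsin : |Real.sin (2 * Real.pi * (θ - c))| ≤ 4 * L :=
    (Real.abs_sin_le_abs).trans (hφ.trans (by nlinarith [Real.pi_le_four]))
  refine ⟨?_, ?_, not_lt.1 hρ, hr⟩
  · nlinarith [abs_nonneg t]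
  · nlinarith [abs_nonneg t, abs_nonneg (Real.sin (2 * Real.pi * (θ - c)))]

theorem exists_unit_mul_eq_abs (a : ℝ) : ∃ σ : ℝ, |σ| = 1 ∧ σ * a = |a| := by
  rcases le_total 0 a with h | h
  · exact ⟨1, by simp, by rw [one_mul, abs_of_nonneg h]⟩
  · exact ⟨-1, by simp, by rw [abs_of_nonpos h]; ring⟩

theorem abs_unit_mul_sub {σ : ℝ} (hσ : |σ| = 1) (a b : ℝ) : |σ * a - σ * b| = |a - b| := by
  rw [← mul_sub, abs_mul, hσ, one_mul]

set_option maxHeartbeats 1000000 in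
/-- the key geometric lemma. -/
theorem statement16 (α ρ : ℝ) (hα : 1 < α) (hρ0 : 0 < ρ) (hρ1 : ρ < 1) :
    ∃ cJ cl Λ c' C' : ℝ,
      0 < cJ ∧ cJ < 1 ∧ 0 < cl ∧ cl < 1 ∧ ρ⁻¹ < Λ ∧ 0 < c' ∧ c' ≤ C' ∧
      ∀ (M A : ℝ) (cJ₀ ℓJ : ℝ) (E F : Set R2) (z₀ x : R2) (r R : ℝ),
        1 ≤ M → 1 ≤ A →
        0 < ℓJ → ℓJ ≤ cJ * M⁻¹ * A⁻¹ →
        AhlforsRegular A E →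
        z₀ ∈ E → 0 < r → r < R →
        F ⊆ E ∩ bmet cJ₀ ℓJ z₀ R →
        (μH[1].restrict E) (bmet cJ₀ ℓJ z₀ (Λ * r)) ≤ ENNReal.ofReal (M * ℓJ * r) →
        (∀ z ∈ bmet cJ₀ ℓJ z₀ (Λ * r) ∩ E,
          coneA z (itv cJ₀ ℓJ) ((cl * M⁻¹ * A⁻¹) * r) (Λ * R) ∩ F = ∅) →
        x ∈ bmet cJ₀ ℓJ z₀ r ∩ F →
        (coneA x (itv cJ₀ (α * ℓJ) \ itv cJ₀ ℓJ) (ρ * r) r ∩ E).Nonempty →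
        ∃ t s : ℝ, 0 < s ∧
          (projPerp cJ₀ '' F) ∩ Set.Icc (t - s/2) (t + s/2) = ∅ ∧
          c' * (cl * M⁻¹ * A⁻¹) * ℓJ * r ≤ s ∧
          s ≤ C' * (cl * M⁻¹ * A⁻¹) * ℓJ * r ∧
          projPerp cJ₀ '' bmet cJ₀ ℓJ z₀ r ⊆
            Set.Icc (t - (cl * M⁻¹ * A⁻¹)⁻¹ * Λ * s / 2)
              (t + (cl * M⁻¹ * A⁻¹)⁻¹ * Λ * s / 2) := by
  have hα0 : 0 < α := by linarith
  refine ⟨ρ / (32 * α), ρ / 16, 10 * α + 10 + ρ⁻¹, 1, 1, by positivity, ?_, by positivity,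
    by linarith, by linarith, one_pos, le_rfl, ?_⟩
  · rw [div_lt_one (by positivity)]
    linarith
  intro M A c ℓ E F z₀ x r R hM hA hℓ hℓle hE hz₀ hr hrR hFsub hμ hcone hx hy
  obtain ⟨y, hyc, hyE⟩ := hy
  obtain ⟨hxB, hxF⟩ := hx
  have hFE : F ⊆ E := fun p hp => (hFsub hp).1
  have hM0 : 0 < M := by linarith
  have hA0 : 0 < A := by linarith
  have hρi : 0 < ρ⁻¹ := inv_pos.2 hρ0
  have hEm : MeasurableSet E := hE.1.measurableSet
  rw [Measure.restrict_apply' hEm] at hμ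
  set lam := ρ / 16 * M⁻¹ * A⁻¹ with hlam
  set Λ := 10 * α + 10 + ρ⁻¹ with hΛ
  have hlam0 : 0 < lam := by positivity
  have hlamMA : lam * (M * A) = ρ / 16 := by rw [hlam]; field_simp
  have hMA : 1 ≤ M * A := one_le_mul_of_one_le_of_one_le hM hA
  have hlam1 : lam ≤ ρ / 16 := by nlinarith
  have hℓMA : α * ℓ * (M * A) ≤ ρ / 32 := by
    calc α * ℓ * (M * A) ≤ α * (ρ / (32 * α) * M⁻¹ * A⁻¹) * (M * A) := by gcongr
      _ = ρ / 32 := by field_simp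
  have hαℓ : α * ℓ ≤ ρ / 32 := by
    nlinarith [mul_pos hα0 hℓ]
  have hℓα : ℓ ≤ α * ℓ := by nlinarith
  have hℓ1 : ℓ ≤ 1 := by linarith
  set δ := lam * r with hδ
  have hδ0 : 0 < δ := by positivity
  have hδr : δ ≤ ρ / 16 * r := by rw [hδ]; gcongr
  have hρr : ρ * r ≤ r := by nlinarith
  have hρr0 : 0 < ρ * r := by positivity
  have hyc' : y ∈ coneA x (itv c (α * ℓ)) (ρ * r) r := by
    obtain ⟨⟨hyc1, hyc2⟩, hyc3⟩ := hyc
    exact ⟨⟨biUnion_subset_biUnion_left sdiff_subset hyc1, hyc2⟩, hyc3⟩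
  obtain ⟨hyU, hyV, hxy, hxy'⟩ := proj_bounds_of_mem_coneA (by linarith) hyc'
  have hxu := abs_proj_sub_lt_of_mem_bmet hxB
  have hxv := abs_projPerp_sub_lt_of_mem_bmet hℓ hxB
  obtain ⟨σ, hσ, hσy⟩ := exists_unit_mul_eq_abs (proj c y - proj c x)
  obtain ⟨τ, hτ, hτy⟩ := exists_unit_mul_eq_abs (projPerp c y - projPerp c x)
  set U : R2 → ℝ := fun p => σ * proj c p with hU
  set V : R2 → ℝ := fun p => τ * projPerp c p with hV
  have hUsub : ∀ p q, |U p - U q| = |proj c p - proj c q| := fun p q => abs_unit_mul_sub hσ _ _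
  have hVsub : ∀ p q, |V p - V q| = |projPerp c p - projPerp c q| :=
    fun p q => abs_unit_mul_sub hτ _ _
  have hUd : ∀ p q, |U p - U q| ≤ dist p q := fun p q => by
    rw [hUsub]; exact abs_proj_sub_le_dist c p q
  have hVd : ∀ p q, |V p - V q| ≤ dist p q := fun p q => by
    rw [hVsub]; exact abs_projPerp_sub_le_dist c p q
  have hUyx : U y - U x = |proj c y - proj c x| := by rw [← hσy, hU]; ring
  have hVyx : V y - V x = |projPerp c y - projPerp c x| := by rw [← hτy, hV]; ring
  have hUy : U y - U x ≤ r := by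
    rw [hUyx, abs_sub_comm]
    exact (abs_proj_sub_le_dist c x y).trans hxy'.le
  have htri : ∀ (f : R2 → ℝ) (q : R2), |f q - f z₀| ≤ |f q - f x| + |f x - f z₀| :=
    fun f q => abs_sub_le _ _ _
  have hΛr : (10 * α + 10) * r < Λ * r := mul_lt_mul_of_pos_right (by linarith) hr
  have hF : ∀ z ∈ E, ∀ p ∈ F, |U z - U x| ≤ 2 * α * r → |V z - V x| ≤ (4 * α * r) * ℓ →
      δ ≤ dist z p → 3 * ℓ * |U p - U z| < |V p - V z| := by
    intro z hz p hp hzU hzV hzp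
    by_contra! hcon
    rw [hUsub, hVsub] at hcon
    rw [hUsub] at hzU
    rw [hVsub] at hzV
    have hz1 : |proj c z - proj c z₀| ≤ (2 * α + 1) * r := by
      linarith [htri (proj c) z]
    have hz2 : |projPerp c z - projPerp c z₀| ≤ ((4 * α + 1) * r) * ℓ := by
      linarith [htri (projPerp c) z]
    have hαr : 0 < α * r := by positivity
    have hzB : z ∈ bmet c ℓ z₀ (Λ * r) := mem_bmet_of_le hℓ hz1 hz2 (by linarith)
    have hzd : dist z z₀ ≤ (6 * α + 2) * r := by
      have h1 : ((4 * α + 1) * r) * ℓ ≤ (4 * α + 1) * r :=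
        mul_le_of_le_one_right (by positivity) hℓ1
      linarith [dist_le_of_abs_le hz1 (hz2.trans h1)]
    have hpd : dist z₀ p < R := dist_lt_of_mem_bmet hℓ hℓ1 (hFsub hp).2
    have hzpd : dist z p < Λ * R := by
      have h1 : (6 * α + 2) * r ≤ (6 * α + 2) * R := by gcongr
      have h2 : (6 * α + 3) * R ≤ Λ * R :=
        mul_le_mul_of_nonneg_right (by linarith) (hr.trans hrR).le
      linarith [dist_triangle z z₀ p]
    have hmem : p ∈ coneA z (itv c ℓ) δ (Λ * R) ∩ F :=
      ⟨⟨⟨mem_cone_of_abs_le hℓ.le hcon, by rwa [mem_ball, dist_comm]⟩,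
        by rw [mem_ball, dist_comm]; exact hzp.not_gt⟩, hp⟩
    rw [hcone z ⟨hzB, hz⟩] at hmem
    exact hmem
  have hB : ∀ q, |U q - U x| ≤ 2 * r → |V q - V x| ≤ 4 * α * r * ℓ + r * ℓ →
      q ∈ bmet c ℓ z₀ (Λ * r) := by
    intro q hq1 hq2
    rw [hUsub] at hq1
    rw [hVsub] at hq2
    refine mem_bmet_of_le (a := 3 * r) (b := (4 * α + 2) * r) hℓ ?_ ?_ ?_
    · linarith [htri (proj c) q]
    · linarith [htri (projPerp c) q]
    · nlinarith [mul_pos hα0 hr]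
  set ε := min (δ / 2) (r * ℓ) with hε
  have hε0 : 0 < ε := lt_min (by positivity) (by positivity)
  have hεδ : ε ≤ δ / 2 := min_le_left _ _
  have hreg : ∀ p ∈ E, ENNReal.ofReal (A⁻¹ * ε) ≤ μH[1] (E ∩ ball p ε) := by
    intro p hp
    refine (hE.2 p hp ε hε0 ?_).1
    refine lt_of_lt_of_le ?_ (edist_le_ediam_of_mem (hFE hxF) hyE)
    rw [edist_dist]
    exact (ENNReal.ofReal_lt_ofReal_iff (by linarith)).2 (by linarith)
  set n := ⌊4 * (M * A)⌋₊ with hn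
  have hn1 : (n : ℝ) ≤ 4 * (M * A) := Nat.floor_le (by positivity)
  have hn2 : 4 * (M * A) < n + 1 := Nat.lt_floor_add_one _
  have hδMA : δ * (M * A) = ρ * r / 16 := by rw [hδ]; linear_combination r * hlamMA
  have hnδ : 2 * n * δ ≤ ρ * r / 2 := by
    linarith [mul_le_mul_of_nonneg_left hn1 hδ0.le]
  have hlt : M * ℓ * r < n * (A⁻¹ * ε) := by
    have h3 : 3 * M * ε ≤ n * (A⁻¹ * ε) := by
      have : 3 * M ≤ n * A⁻¹ := by rw [← div_eq_mul_inv, le_div_iff₀ hA0]; linarith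
      linarith [mul_le_mul_of_nonneg_right this hε0.le]
    refine lt_of_lt_of_le ?_ h3
    rcases min_choice (δ / 2) (r * ℓ) with h | h
    · rw [hε, h, ← mul_lt_mul_iff_left₀ hA0]
      have h4 : ℓ * (M * A) ≤ ρ / 32 :=
        le_trans (by gcongr) hℓMA
      have h5 : ℓ * (M * A) * r ≤ ρ / 32 * r := by gcongr
      linarith
    · rw [hε, h]
      have : 0 < M * ℓ * r := by positivity
      linarith
  obtain ⟨i, hi, hwin⟩ := exists_empty_window (n := n) hEm hFE U V hUd hVd hδ0 hεδ
    (by linarith) (min_le_right _ _) (by linarith) hB hreg hμ (by positivity) hlt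
  have hin : ((i : ℕ) : ℝ) + 1 ≤ n := by exact_mod_cast hi
  have hi0 : (0 : ℝ) ≤ i := Nat.cast_nonneg _
  have hαr : r ≤ α * r := by nlinarith
  obtain ⟨m, hm1, hm2, hm⟩ := exists_gap_of_empty_window (x := x) (y := y)
    (w := U x + (2 * i + 1) * δ) (H := 4 * α * r) (K := 2 * α * r) hFE U V hUd hδ0 hℓ hxF hyE
    (by linarith [mul_nonneg hi0 hδ0.le])
    (by linarith [mul_le_mul_of_nonneg_right hin hδ0.le]) (by linarith [abs_nonneg (projPerp c y - projPerp c x)])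
    (by linarith) (by linarith) (by linarith) hF
    (fun p hp h1 h2 => (hwin p hp h1 h2).imp id fun h => by linarith)
  have hττ : τ * τ = 1 := by rw [← abs_mul_abs_self, hτ, one_mul]
  have hℓδ : 0 < ℓ * δ := by positivity
  have hs : lam⁻¹ * Λ * (ℓ * δ) / 2 = Λ * r * ℓ / 2 := by
    rw [hδ]; field_simp
  refine ⟨τ * (m - 3 / 2 * (ℓ * δ)), ℓ * δ, hℓδ, ?_, ?_, ?_, ?_⟩
  · refine eq_empty_of_forall_notMem ?_
    rintro _ ⟨⟨p, hp, rfl⟩, h1, h2⟩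
    have h3 : |V p - (m - 3 / 2 * (ℓ * δ))| ≤ ℓ * δ / 2 := by
      have h4 : |projPerp c p - τ * (m - 3 / 2 * (ℓ * δ))| ≤ ℓ * δ / 2 :=
        abs_le.2 ⟨by linarith, by linarith⟩
      rwa [← abs_unit_mul_sub hτ, ← mul_assoc, hττ, one_mul] at h4
    obtain ⟨h5, h6⟩ := abs_le.1 h3
    rcases hm p hp with h | h <;> linarith
  · rw [hδ]; linarith
  · rw [hδ]; linarith
  · rintro _ ⟨q, hq, rfl⟩
    have hqv := abs_projPerp_sub_lt_of_mem_bmet hℓ hq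
    have h1 : |m - 3 / 2 * (ℓ * δ) - V x| ≤ 4 * α * r * ℓ + r * ℓ := by
      have : ℓ * δ ≤ ℓ * (r / 2) := by gcongr; linarith
      have : 0 < α * r * ℓ := by positivity
      exact abs_le.2 ⟨by linarith, by linarith⟩
    have h2 : |τ * (m - 3 / 2 * (ℓ * δ)) - projPerp c x| ≤ 4 * α * r * ℓ + r * ℓ := by
      rwa [← abs_unit_mul_sub hτ, ← mul_assoc, hττ, one_mul]
    have h3 : (10 * α + 10) * r * ℓ ≤ Λ * r * ℓ := by gcongr
    rw [mem_Icc, hs]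
    have := abs_le.1 h2
    have := abs_lt.1 hqv
    have := abs_lt.1 hxv
    have : 0 < r * ℓ := by positivity
    constructor <;> linarith

end
end

section
/- There is an absolute constant C ≥ 1 such that the following holds. Let E ⊂ [0,1]² be Ahlfors regular with constant A, let k ≥ 0 be an integer with 2^{−k} ≤ diam(E), let 𝔇_k(E) be the family of dyadic squares of sidelength 2^{−k} intersecting E, and for i ∈ {1,2} let F be the union, over Q ∈ 𝔇_k(E), of the two sides of the boundary ∂Q parallel to the x_i-axis. Then F is Ahlfors regular with constant at most C·A², and C⁻¹·A⁻¹·ℋ¹(E) ≤ ℋ¹(F) ≤ C·A·ℋ¹(E). -/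
open MeasureTheory Metric Set
open scoped ENNReal NNReal

noncomputable section

/-- The closed dyadic square of sidelength `2^{-k}` with lower-left corner
`(m·2^{-k}, n·2^{-k})`. -/
def dySq (k : ℕ) (m n : ℤ) : Set R2 :=
  {x | x 0 ∈ Set.Icc ((m : ℝ) * (2:ℝ)^(-(k:ℤ))) (((m : ℝ)+1) * (2:ℝ)^(-(k:ℤ))) ∧
       x 1 ∈ Set.Icc ((n : ℝ) * (2:ℝ)^(-(k:ℤ))) (((n : ℝ)+1) * (2:ℝ)^(-(k:ℤ)))}

/-- The half-open square of the grid of mesh `s` with index `Q`. -/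
def gridCell (s : ℝ) (Q : ℤ × ℤ) : Set R2 := {x | ⌊x 0 / s⌋ = Q.1 ∧ ⌊x 1 / s⌋ = Q.2}

/-- The closed square of the grid of mesh `s` with index `Q`. -/
def gridSquare (s : ℝ) (Q : ℤ × ℤ) : Set R2 :=
  {x | x 0 ∈ Set.Icc ((Q.1 : ℝ) * s) (((Q.1 : ℝ) + 1) * s) ∧
       x 1 ∈ Set.Icc ((Q.2 : ℝ) * s) (((Q.2 : ℝ) + 1) * s)}

lemma mem_gridCell_iff {s : ℝ} (hs : 0 < s) {Q : ℤ × ℤ} {x : R2} :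
    x ∈ gridCell s Q ↔ (Q.1 * s ≤ x 0 ∧ x 0 < (Q.1 + 1) * s) ∧
      (Q.2 * s ≤ x 1 ∧ x 1 < (Q.2 + 1) * s) := by
  simp only [gridCell, Set.mem_ofPred_eq, Int.floor_eq_iff, le_div_iff₀ hs, div_lt_iff₀ hs]

lemma gridCell_subset_gridSquare {s : ℝ} (hs : 0 < s) (Q : ℤ × ℤ) :
    gridCell s Q ⊆ gridSquare s Q := by
  intro x hx
  rw [mem_gridCell_iff hs] at hx
  exact ⟨⟨hx.1.1, hx.1.2.le⟩, ⟨hx.2.1, hx.2.2.le⟩⟩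

lemma mem_gridCell_self (s : ℝ) (x : R2) : x ∈ gridCell s (⌊x 0 / s⌋, ⌊x 1 / s⌋) := ⟨rfl, rfl⟩

lemma measurableSet_gridCell (s : ℝ) (Q : ℤ × ℤ) : MeasurableSet (gridCell s Q) := by
  have h (i : Fin 2) : Measurable fun x : R2 => ⌊x i / s⌋ :=
    Int.measurable_floor.comp (by fun_prop)
  exact ((h 0) (measurableSet_singleton Q.1)).inter ((h 1) (measurableSet_singleton Q.2))

lemma disjoint_gridCell (s : ℝ) {P Q : ℤ × ℤ} (h : P ≠ Q) :
    Disjoint (gridCell s P) (gridCell s Q) := by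
  rw [Set.disjoint_left]
  rintro x ⟨h1, h2⟩ ⟨h3, h4⟩
  exact h (Prod.ext (h1.symm.trans h3) (h2.symm.trans h4))

lemma abs_coord_sub_le_dist (x y : R2) (i : Fin 2) : |x i - y i| ≤ dist x y :=
  PiLp.dist_apply_le x y i

lemma dist_le_add_abs_coord_sub (x y : R2) : dist x y ≤ |x 0 - y 0| + |x 1 - y 1| := by
  rw [EuclideanSpace.dist_eq, Fin.sum_univ_two, Real.dist_eq, Real.dist_eq]
  apply Real.sqrt_le_iff.mpr
  constructor
  · positivity
  · nlinarith [abs_nonneg (x 0 - y 0), abs_nonneg (x 1 - y 1)]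

lemma dist_le_of_mem_gridSquare {s : ℝ} {Q : ℤ × ℤ} {x y : R2} (hx : x ∈ gridSquare s Q)
    (hy : y ∈ gridSquare s Q) : dist x y ≤ 2 * s := by
  refine (dist_le_add_abs_coord_sub x y).trans ?_
  obtain ⟨⟨a1, a2⟩, a3, a4⟩ := hx
  obtain ⟨⟨b1, b2⟩, b3, b4⟩ := hy
  have h1 : |x 0 - y 0| ≤ s := abs_le.mpr ⟨by linarith, by linarith⟩
  have h2 : |x 1 - y 1| ≤ s := abs_le.mpr ⟨by linarith, by linarith⟩
  linarith

lemma sum_measure_inter_gridCell_le (μ : Measure R2) (W : Set R2) (s : ℝ) (S : Finset (ℤ × ℤ))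
    (v : ℤ × ℤ) : ∑ Q ∈ S, μ (W ∩ gridCell s (Q + v)) ≤ μ W := by
  have h := sum_measure_le_measure_univ (μ := μ.restrict W) (s := S)
    (t := fun Q => gridCell s (Q + v))
    (fun Q _ => (measurableSet_gridCell s _).nullMeasurableSet)
    (fun P _ Q _ hPQ => (disjoint_gridCell s (by simpa using hPQ)).aedisjoint)
  simpa [Measure.restrict_apply (measurableSet_gridCell s _), Set.inter_comm] using h

/-- Indices whose coordinates differ by at most `n` from those of the cell containing `x`. -/
def nearIndices (s : ℝ) (x : R2) (n : ℤ) : Finset (ℤ × ℤ) :=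
  Finset.Icc (⌊x 0 / s⌋ - n) (⌊x 0 / s⌋ + n) ×ˢ Finset.Icc (⌊x 1 / s⌋ - n) (⌊x 1 / s⌋ + n)

lemma card_nearIndices (s : ℝ) (x : R2) (n : ℕ) : (nearIndices s x n).card = (2 * n + 1) ^ 2 := by
  rw [nearIndices, Finset.card_product, Int.card_Icc, Int.card_Icc, sq]
  congr 1 <;> omega

lemma mem_nearIndices {s : ℝ} (hs : 0 < s) {x y : R2} {n : ℤ} {Q : ℤ × ℤ}
    (hy : y ∈ gridSquare s Q) (hxy : dist x y ≤ n * s) : Q ∈ nearIndices s x (n + 1) := by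
  have key (i : Fin 2) (q : ℤ) (h : y i ∈ Set.Icc (q * s) ((q + 1) * s)) :
      q ∈ Finset.Icc (⌊x i / s⌋ - (n + 1)) (⌊x i / s⌋ + (n + 1)) := by
    have hd := abs_le.mp ((abs_coord_sub_le_dist x y i).trans hxy)
    have h1 := Int.floor_le (x i / s)
    have h2 := Int.lt_floor_add_one (x i / s)
    rw [le_div_iff₀ hs] at h1
    rw [div_lt_iff₀ hs] at h2
    have h3 : ((q : ℝ)) * s < (⌊x i / s⌋ + n + 1) * s := by linarith [h.1, hd.1]
    have h4 : ((⌊x i / s⌋ : ℝ)) * s ≤ (q + 1 + n) * s := by linarith [h.2, hd.2]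
    have h3 := lt_of_mul_lt_mul_right h3 hs.le
    have h4 := le_of_mul_le_mul_right h4 hs
    have h3 : q < ⌊x i / s⌋ + n + 1 := by exact_mod_cast h3
    have h4 : ⌊x i / s⌋ ≤ q + 1 + n := by exact_mod_cast h4
    rw [Finset.mem_Icc]
    omega
  exact Finset.mem_product.mpr ⟨key 0 _ hy.1, key 1 _ hy.2⟩

lemma measure_le_card_mul_of_subset_biUnion (μ : Measure R2) {W : Set R2} {S : Finset (ℤ × ℤ)}
    {t : ℤ × ℤ → Set R2} {c : ℝ≥0∞} (hW : W ⊆ ⋃ Q ∈ S, t Q) (h : ∀ Q ∈ S, μ (t Q) ≤ c) :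
    μ W ≤ S.card * c := by
  calc μ W ≤ μ (⋃ Q ∈ S, t Q) := measure_mono hW
    _ ≤ ∑ Q ∈ S, μ (t Q) := measure_biUnion_finset_le S t
    _ ≤ S.card • c := Finset.sum_le_card_nsmul S _ c h
    _ = S.card * c := nsmul_eq_mul _ _

section Regular

variable {A : ℝ} {E : Set R2}

lemma AhlforsRegular.lower (h : AhlforsRegular A E) (hb : Bornology.IsBounded E) {x : R2}
    (hx : x ∈ E) {r : ℝ} (hr : 0 < r) (hrD : r < Metric.diam E) :
    ENNReal.ofReal (A⁻¹ * r) ≤ μH[1] (E ∩ ball x r) :=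
  (h.2 x hx r hr ((ENNReal.ofReal_lt_iff_lt_toReal hr.le hb.ediam_ne_top).mpr hrD)).1

lemma AhlforsRegular.upper (h : AhlforsRegular A E) (hb : Bornology.IsBounded E) {x : R2}
    (hx : x ∈ E) {r : ℝ} (hr : 0 < r) (hrD : r < Metric.diam E) :
    μH[1] (E ∩ ball x r) ≤ ENNReal.ofReal (A * r) :=
  (h.2 x hx r hr ((ENNReal.ofReal_lt_iff_lt_toReal hr.le hb.ediam_ne_top).mpr hrD)).2

lemma AhlforsRegular.measure_le_diam (h : AhlforsRegular A E) (hb : Bornology.IsBounded E)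
    (hA : 1 ≤ A) (hD : 0 < Metric.diam E) :
    μH[1] E ≤ ENNReal.ofReal (121 * (A * Metric.diam E)) := by
  set D := Metric.diam E with hDdef
  obtain ⟨p, hp⟩ : E.Nonempty := by
    by_contra hne
    rw [Set.not_nonempty_iff_eq_empty] at hne
    simp [hDdef, hne] at hD
  have hs : 0 < D / 4 := by positivity
  have hcov : E ⊆ ⋃ Q ∈ nearIndices (D / 4) p (5 : ℕ), E ∩ gridCell (D / 4) Q := by
    intro y hy
    have hc := mem_gridCell_self (D / 4) y
    refine mem_iUnion₂.mpr ⟨_, ?_, hy, hc⟩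
    refine mem_nearIndices (n := 4) hs (gridCell_subset_gridSquare hs _ hc) ?_
    have := dist_le_diam_of_mem hb hp hy
    push_cast
    linarith
  have hcell : ∀ Q ∈ nearIndices (D / 4) p (5 : ℕ),
      μH[1] (E ∩ gridCell (D / 4) Q) ≤ ENNReal.ofReal (A * D) := by
    intro Q _
    rcases (E ∩ gridCell (D / 4) Q).eq_empty_or_nonempty with he | ⟨q, hq, hqc⟩
    · simp [he]
    calc μH[1] (E ∩ gridCell (D / 4) Q) ≤ μH[1] (E ∩ ball q (3 / 4 * D)) := by
          apply measure_mono
          rintro y ⟨hy, hyc⟩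
          refine ⟨hy, ?_⟩
          have := dist_le_of_mem_gridSquare (gridCell_subset_gridSquare hs _ hyc)
            (gridCell_subset_gridSquare hs _ hqc)
          rw [mem_ball]
          linarith
      _ ≤ ENNReal.ofReal (A * (3 / 4 * D)) :=
          h.upper hb hq (by positivity) (by linarith)
      _ ≤ ENNReal.ofReal (A * D) := by gcongr; linarith
  refine (measure_le_card_mul_of_subset_biUnion _ hcov hcell).trans_eq ?_
  rw [card_nearIndices, ENNReal.ofReal_mul (p := 121) (by norm_num)]
  norm_num

lemma AhlforsRegular.measure_inter_ball_le (h : AhlforsRegular A E)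
    (hb : Bornology.IsBounded E) (hA : 1 ≤ A) (hD : 0 < Metric.diam E) (y : R2) {r : ℝ}
    (hr : 0 < r) : μH[1] (E ∩ ball y r) ≤ ENNReal.ofReal (242 * A * r) := by
  rcases (E ∩ ball y r).eq_empty_or_nonempty with he | ⟨p, hp, hpy⟩
  · simp [he]
  rcases lt_or_ge (2 * r) (Metric.diam E) with hlt | hge
  · calc μH[1] (E ∩ ball y r) ≤ μH[1] (E ∩ ball p (2 * r)) := by
          gcongr
          apply ball_subset_ball'
          rw [mem_ball, dist_comm] at hpy
          linarith
      _ ≤ ENNReal.ofReal (A * (2 * r)) := h.upper hb hp (by positivity) hlt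
      _ ≤ ENNReal.ofReal (242 * A * r) := by
          apply ENNReal.ofReal_le_ofReal
          have : 0 < A * r := by positivity
          linarith
  · calc μH[1] (E ∩ ball y r) ≤ μH[1] E := measure_mono inter_subset_left
      _ ≤ ENNReal.ofReal (121 * (A * Metric.diam E)) := h.measure_le_diam hb hA hD
      _ ≤ ENNReal.ofReal (242 * A * r) := by
          apply ENNReal.ofReal_le_ofReal
          have : A * Metric.diam E ≤ A * (2 * r) := by gcongr
          linarith

/-- Squares of the grid meeting `E` carry, up to bounded overlap, a definite part of `E`. -/
lemma AhlforsRegular.card_mul_le (h : AhlforsRegular A E) (hb : Bornology.IsBounded E)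
    (hA : 1 ≤ A) {s : ℝ} (hs : 0 < s) (hsD : s ≤ Metric.diam E) (S : Finset (ℤ × ℤ)) (V : Set R2)
    (hS : ∀ Q ∈ S, ∃ p ∈ gridSquare s Q ∩ E, ball p (s / 2) ⊆ V) :
    ENNReal.ofReal (S.card * s) ≤ ENNReal.ofReal (18 * A) * μH[1] (E ∩ V) := by
  let I : Finset (ℤ × ℤ) := Finset.Icc (-1) 1 ×ˢ Finset.Icc (-1) 1
  have hI : I.card = 9 := rfl
  have hQ : ∀ Q ∈ S, ENNReal.ofReal (A⁻¹ * (s / 2)) ≤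
      ∑ v ∈ I, μH[1] (E ∩ V ∩ gridCell s (Q + v)) := by
    intro Q hQS
    obtain ⟨p, ⟨hpQ, hpE⟩, hpV⟩ := hS Q hQS
    refine (h.lower hb hpE (by positivity) (by linarith)).trans ?_
    refine le_trans (measure_mono ?_) (measure_biUnion_finset_le I _)
    rintro y ⟨hyE, hyp⟩
    have key (i : Fin 2) (q : ℤ) (hq : p i ∈ Set.Icc (q * s) ((q + 1) * s)) :
        ⌊y i / s⌋ - q ∈ Finset.Icc (-1 : ℤ) 1 := by
      have hd := abs_lt.mp ((abs_coord_sub_le_dist y p i).trans_lt hyp)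
      have h1 : ((q - 1 : ℤ) : ℝ) ≤ y i / s := by
        rw [le_div_iff₀ hs]; push_cast; linarith [hq.1, hd.1]
      have h2 : y i / s < ((q + 2 : ℤ) : ℝ) := by
        rw [div_lt_iff₀ hs]; push_cast; linarith [hq.2, hd.2]
      have h1 := Int.le_floor.mpr h1
      have h2 := Int.floor_lt.mpr h2
      rw [Finset.mem_Icc]
      omega
    refine mem_iUnion₂.mpr ⟨(⌊y 0 / s⌋ - Q.1, ⌊y 1 / s⌋ - Q.2),
      Finset.mem_product.mpr ⟨key 0 _ hpQ.1, key 1 _ hpQ.2⟩, ⟨hyE, hpV hyp⟩, ?_⟩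
    exact ⟨by simp, by simp⟩
  have hsum : (S.card : ℝ≥0∞) * ENNReal.ofReal (A⁻¹ * (s / 2)) ≤ 9 * μH[1] (E ∩ V) := by
    calc (S.card : ℝ≥0∞) * ENNReal.ofReal (A⁻¹ * (s / 2))
        = ∑ _Q ∈ S, ENNReal.ofReal (A⁻¹ * (s / 2)) := by simp
      _ ≤ ∑ Q ∈ S, ∑ v ∈ I, μH[1] (E ∩ V ∩ gridCell s (Q + v)) := Finset.sum_le_sum hQ
      _ = ∑ v ∈ I, ∑ Q ∈ S, μH[1] (E ∩ V ∩ gridCell s (Q + v)) := Finset.sum_comm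
      _ ≤ I.card • μH[1] (E ∩ V) :=
          Finset.sum_le_card_nsmul _ _ _ fun v _ => sum_measure_inter_gridCell_le _ _ _ _ _
      _ = 9 * μH[1] (E ∩ V) := by rw [hI]; simp
  have hA0 : A ≠ 0 := by positivity
  calc ENNReal.ofReal (S.card * s)
      = ENNReal.ofReal (2 * A) * (S.card * ENNReal.ofReal (A⁻¹ * (s / 2))) := by
        rw [← ENNReal.ofReal_natCast, ← ENNReal.ofReal_mul (by positivity),
          ← ENNReal.ofReal_mul (by positivity)]
        congr 1
        field_simp
    _ ≤ ENNReal.ofReal (2 * A) * (9 * μH[1] (E ∩ V)) := by gcongr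
    _ = ENNReal.ofReal (18 * A) * μH[1] (E ∩ V) := by
        rw [← mul_assoc, ← ENNReal.ofReal_ofNat 9, ← ENNReal.ofReal_mul (by positivity)]
        congr 2
        ring

lemma AhlforsRegular.measure_inter_le_card_mul (h : AhlforsRegular A E)
    (hb : Bornology.IsBounded E) (hA : 1 ≤ A) {s : ℝ} (hs : 0 < s) (hsD : s ≤ Metric.diam E)
    (S : Finset (ℤ × ℤ)) (W : Set R2) (hW : E ∩ W ⊆ ⋃ Q ∈ S, gridCell s Q) :
    μH[1] (E ∩ W) ≤ ENNReal.ofReal (726 * A) * ENNReal.ofReal (S.card * s) := by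
  have hcov : E ∩ W ⊆ ⋃ Q ∈ S, E ∩ gridCell s Q := by
    intro y hy
    obtain ⟨Q, hQ, hyQ⟩ := mem_iUnion₂.mp (hW hy)
    exact mem_iUnion₂.mpr ⟨Q, hQ, hy.1, hyQ⟩
  have hcell : ∀ Q ∈ S, μH[1] (E ∩ gridCell s Q) ≤ ENNReal.ofReal (242 * A * (3 * s)) := by
    intro Q _
    rcases (gridCell s Q).eq_empty_or_nonempty with he | ⟨q, hq⟩
    · simp [he]
    refine le_trans (measure_mono ?_)
      (h.measure_inter_ball_le hb hA (hs.trans_le hsD) q (by positivity))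
    gcongr
    intro y hy
    have := dist_le_of_mem_gridSquare (gridCell_subset_gridSquare hs _ hy)
      (gridCell_subset_gridSquare hs _ hq)
    rw [mem_ball]
    linarith
  refine (measure_le_card_mul_of_subset_biUnion _ hcov hcell).trans_eq ?_
  rw [← ENNReal.ofReal_natCast, ← ENNReal.ofReal_mul (by positivity),
    ← ENNReal.ofReal_mul (by positivity)]
  congr 1
  ring

end Regular

section Segment

variable {f : ℝ → R2}

lemma hausdorffMeasure_isometry_image (hf : Isometry f) (u : Set ℝ) :
    μH[1] (f '' u) = volume u := by
  rw [hf.hausdorffMeasure_image (Or.inl zero_le_one), hausdorffMeasure_real]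

lemma hausdorffMeasure_isometry_image_inter_ball_le (hf : Isometry f) (u : Set ℝ) (x : R2)
    (r : ℝ) : μH[1] (f '' u ∩ ball x r) ≤ ENNReal.ofReal (4 * r) := by
  rcases (f '' u ∩ ball x r).eq_empty_or_nonempty with he | ⟨_, ⟨t, _, rfl⟩, htx⟩
  · simp [he]
  calc μH[1] (f '' u ∩ ball x r) ≤ μH[1] (f '' ball t (2 * r)) := by
        apply measure_mono
        rintro _ ⟨⟨t', _, rfl⟩, ht'⟩
        refine ⟨t', ?_, rfl⟩
        rw [mem_ball, ← hf.dist_eq]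
        rw [mem_ball] at htx ht'
        linarith [dist_triangle_right (f t') (f t) x]
    _ = ENNReal.ofReal (4 * r) := by
        rw [hausdorffMeasure_isometry_image hf, Real.volume_ball]
        congr 1
        ring

lemma le_hausdorffMeasure_isometry_image_Icc_inter_ball (hf : Isometry f) {a s r : ℝ}
    (hr : 0 < r) (hrs : r ≤ s) {x : R2} (hx : x ∈ f '' Set.Icc a (a + s)) :
    ENNReal.ofReal (r / 2) ≤ μH[1] (f '' Set.Icc a (a + s) ∩ ball x r) := by
  obtain ⟨t, ht, rfl⟩ := hx
  have key (b : ℝ) (hb : a ≤ b) (hb' : b + r / 2 ≤ a + s) (h1 : b ≤ t) (h2 : t ≤ b + r / 2) :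
      ENNReal.ofReal (r / 2) ≤ μH[1] (f '' Set.Icc a (a + s) ∩ ball (f t) r) := by
    calc ENNReal.ofReal (r / 2) = μH[1] (f '' Set.Icc b (b + r / 2)) := by
          rw [hausdorffMeasure_isometry_image hf, Real.volume_Icc]
          congr 1
          ring
      _ ≤ _ := by
          apply measure_mono
          rintro _ ⟨t', ht', rfl⟩
          refine ⟨⟨t', ⟨hb.trans ht'.1, ht'.2.trans hb'⟩, rfl⟩, ?_⟩
          rw [mem_ball, hf.dist_eq, Real.dist_eq, abs_lt]
          constructor <;> linarith [ht'.1, ht'.2]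
  rcases le_total (t + r / 2) (a + s) with h | h
  · exact key t ht.1 h le_rfl (by linarith)
  · exact key (t - r / 2) (by linarith) (by linarith [ht.2]) (by linarith) (by linarith)

end Segment

/-- A choice of two parametrized sides for each square of the grid of mesh `s`, the first of
which lies in the half-open square up to an endpoint. -/
structure EdgePairs (s : ℝ) where
  first : ℤ × ℤ → ℝ → R2
  second : ℤ × ℤ → ℝ → R2
  start : ℤ × ℤ → ℝ
  isometry_first : ∀ Q, Isometry (first Q)
  isometry_second : ∀ Q, Isometry (second Q)
  first_Icc_subset : ∀ Q, first Q '' Set.Icc (start Q) (start Q + s) ⊆ gridSquare s Q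
  second_Icc_subset : ∀ Q, second Q '' Set.Icc (start Q) (start Q + s) ⊆ gridSquare s Q
  first_Ico_subset : ∀ Q, first Q '' Set.Ico (start Q) (start Q + s) ⊆ gridCell s Q

namespace EdgePairs

variable {s : ℝ} (T : EdgePairs s)

/-- The union of the two chosen sides of the square with index `Q`. -/
def edges (Q : ℤ × ℤ) : Set R2 :=
  T.first Q '' Set.Icc (T.start Q) (T.start Q + s) ∪
    T.second Q '' Set.Icc (T.start Q) (T.start Q + s)

/-- The union of the chosen sides of the squares meeting `E`. -/
def skeleton (E : Set R2) : Set R2 :=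
  ⋃ (Q : ℤ × ℤ) (_ : (gridSquare s Q ∩ E).Nonempty), T.edges Q

lemma edges_subset (Q : ℤ × ℤ) : T.edges Q ⊆ gridSquare s Q :=
  union_subset (T.first_Icc_subset Q) (T.second_Icc_subset Q)

lemma isClosed_edges (Q : ℤ × ℤ) : IsClosed (T.edges Q) :=
  ((isCompact_Icc.image (T.isometry_first Q).continuous).union
    (isCompact_Icc.image (T.isometry_second Q).continuous)).isClosed

lemma measure_edges_le (hs : 0 < s) (Q : ℤ × ℤ) : μH[1] (T.edges Q) ≤ ENNReal.ofReal (2 * s) := by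
  refine (measure_union_le _ _).trans_eq ?_
  rw [hausdorffMeasure_isometry_image (T.isometry_first Q),
    hausdorffMeasure_isometry_image (T.isometry_second Q), Real.volume_Icc,
    ← ENNReal.ofReal_add (by linarith) (by linarith)]
  congr 1
  ring

lemma measure_edges_inter_ball_le (Q : ℤ × ℤ) (x : R2) {r : ℝ} (hr : 0 < r) :
    μH[1] (T.edges Q ∩ ball x r) ≤ ENNReal.ofReal (8 * r) := by
  rw [edges, Set.union_inter_distrib_right]
  refine (measure_union_le _ _).trans ?_
  refine (add_le_add
    (hausdorffMeasure_isometry_image_inter_ball_le (T.isometry_first Q) _ x r)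
    (hausdorffMeasure_isometry_image_inter_ball_le (T.isometry_second Q) _ x r)).trans_eq ?_
  rw [← ENNReal.ofReal_add (by positivity) (by positivity)]
  congr 1
  ring

lemma le_measure_edges_inter_ball {Q : ℤ × ℤ} {x : R2} (hx : x ∈ T.edges Q) {r : ℝ}
    (hr : 0 < r) (hrs : r ≤ s) : ENNReal.ofReal (r / 2) ≤ μH[1] (T.edges Q ∩ ball x r) := by
  rcases hx with hx | hx
  · refine (le_hausdorffMeasure_isometry_image_Icc_inter_ball (T.isometry_first Q)
      hr hrs hx).trans (measure_mono ?_)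
    exact inter_subset_inter_left _ subset_union_left
  · refine (le_hausdorffMeasure_isometry_image_Icc_inter_ball (T.isometry_second Q)
      hr hrs hx).trans (measure_mono ?_)
    exact inter_subset_inter_left _ subset_union_right

lemma edges_subset_skeleton {E : Set R2} {Q : ℤ × ℤ} (hQ : (gridSquare s Q ∩ E).Nonempty) :
    T.edges Q ⊆ T.skeleton E :=
  fun _ hx => mem_iUnion₂.mpr ⟨Q, hQ, hx⟩

lemma card_mul_le_measure_skeleton {E V : Set R2} {S : Finset (ℤ × ℤ)}
    (hS : ∀ Q ∈ S, (gridSquare s Q ∩ E).Nonempty) (hV : ∀ Q ∈ S, gridSquare s Q ⊆ V) :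
    ENNReal.ofReal (S.card * s) ≤ μH[1] (T.skeleton E ∩ V) := by
  calc ENNReal.ofReal (S.card * s) = ∑ _Q ∈ S, ENNReal.ofReal s := by
        rw [ENNReal.ofReal_mul (by positivity)]
        simp
    _ ≤ ∑ Q ∈ S, μH[1] (T.skeleton E ∩ V ∩ gridCell s (Q + 0)) := by
        refine Finset.sum_le_sum fun Q hQ => ?_
        calc ENNReal.ofReal s
            = μH[1] (T.first Q '' Set.Ico (T.start Q) (T.start Q + s)) := by
              rw [hausdorffMeasure_isometry_image (T.isometry_first Q), Real.volume_Ico]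
              congr 1
              ring
          _ ≤ _ := by
              rw [add_zero]
              have hsub : T.first Q '' Set.Ico (T.start Q) (T.start Q + s) ⊆ T.edges Q :=
                (image_mono Ico_subset_Icc_self).trans subset_union_left
              exact measure_mono (subset_inter (subset_inter
                (hsub.trans (T.edges_subset_skeleton (hS Q hQ)))
                (hsub.trans ((T.edges_subset Q).trans (hV Q hQ)))) (T.first_Ico_subset Q))
    _ ≤ _ := sum_measure_inter_gridCell_le _ _ _ _ _

lemma finite_indices (hs : 0 < s) {E : Set R2} (hb : Bornology.IsBounded E) :
    {Q : ℤ × ℤ | (gridSquare s Q ∩ E).Nonempty}.Finite := by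
  rcases E.eq_empty_or_nonempty with rfl | ⟨p, hp⟩
  · simp
  refine (nearIndices s p (⌈Metric.diam E / s⌉ + 1)).finite_toSet.subset ?_
  rintro Q ⟨y, hy, hyE⟩
  refine mem_nearIndices hs hy ((dist_le_diam_of_mem hb hp hyE).trans ?_)
  rw [← div_le_iff₀ hs]
  exact Int.le_ceil _

variable {A : ℝ} {E : Set R2}

lemma isClosed_skeleton (hs : 0 < s) (hb : Bornology.IsBounded E) :
    IsClosed (T.skeleton E) :=
  (finite_indices hs hb).isClosed_biUnion fun Q _ => T.isClosed_edges Q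

lemma exists_dist_le_of_mem_skeleton {x : R2} (hx : x ∈ T.skeleton E) :
    ∃ e ∈ E, dist x e ≤ 2 * s := by
  obtain ⟨Q, ⟨e, heQ, he⟩, hxQ⟩ := mem_iUnion₂.mp hx
  exact ⟨e, he, dist_le_of_mem_gridSquare (T.edges_subset Q hxQ) heQ⟩

lemma ediam_skeleton_le (hb : Bornology.IsBounded E) (hsD : s ≤ Metric.diam E) :
    ediam (T.skeleton E) ≤ ENNReal.ofReal (5 * Metric.diam E) := by
  refine ediam_le fun x hx y hy => ?_
  obtain ⟨e, he, hxe⟩ := T.exists_dist_le_of_mem_skeleton hx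
  obtain ⟨e', he', hye⟩ := T.exists_dist_le_of_mem_skeleton hy
  rw [edist_dist]
  apply ENNReal.ofReal_le_ofReal
  have h1 := dist_triangle4 x e e' y
  have h2 := dist_le_diam_of_mem hb he he'
  rw [dist_comm] at hye
  linarith

lemma measure_skeleton_le (h : AhlforsRegular A E) (hb : Bornology.IsBounded E) (hA : 1 ≤ A)
    (hs : 0 < s) (hsD : s ≤ Metric.diam E) :
    μH[1] (T.skeleton E) ≤ ENNReal.ofReal (36 * A) * μH[1] E := by
  have hfin := finite_indices hs hb
  have hcov : T.skeleton E ⊆ ⋃ Q ∈ hfin.toFinset, T.edges Q := by simp [skeleton]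
  calc μH[1] (T.skeleton E) ≤ hfin.toFinset.card * ENNReal.ofReal (2 * s) :=
        measure_le_card_mul_of_subset_biUnion _ hcov fun Q _ => T.measure_edges_le hs Q
    _ = ENNReal.ofReal 2 * ENNReal.ofReal (hfin.toFinset.card * s) := by
        rw [← ENNReal.ofReal_natCast, ← ENNReal.ofReal_mul (by positivity),
          ← ENNReal.ofReal_mul (by positivity)]
        congr 1
        ring
    _ ≤ ENNReal.ofReal 2 * (ENNReal.ofReal (18 * A) * μH[1] (E ∩ univ)) := by
        gcongr
        refine h.card_mul_le hb hA hs hsD _ _ fun Q hQ => ?_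
        obtain ⟨p, hp⟩ := hfin.mem_toFinset.mp hQ
        exact ⟨p, hp, subset_univ _⟩
    _ = _ := by
        rw [inter_univ, ← mul_assoc, ← ENNReal.ofReal_mul (by positivity)]
        congr 2
        ring

lemma measure_le_measure_skeleton (h : AhlforsRegular A E) (hb : Bornology.IsBounded E)
    (hA : 1 ≤ A) (hs : 0 < s) (hsD : s ≤ Metric.diam E) (e : R2) (ρ : ℝ) :
    μH[1] (E ∩ ball e ρ) ≤
      ENNReal.ofReal (726 * A) * μH[1] (T.skeleton E ∩ ball e (ρ + 3 * s)) := by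
  classical
  have hfin := finite_indices hs hb
  set S := hfin.toFinset.filter fun Q => (gridSquare s Q ∩ ball e ρ).Nonempty
  refine (h.measure_inter_le_card_mul hb hA hs hsD S _ ?_).trans ?_
  · rintro y ⟨hyE, hye⟩
    have hc := mem_gridCell_self s y
    have hq := gridCell_subset_gridSquare hs _ hc
    refine mem_iUnion₂.mpr ⟨_, ?_, hc⟩
    exact Finset.mem_filter.mpr ⟨hfin.mem_toFinset.mpr ⟨y, hq, hyE⟩, y, hq, hye⟩
  · gcongr
    refine T.card_mul_le_measure_skeleton
      (fun Q hQ => hfin.mem_toFinset.mp (Finset.mem_filter.mp hQ).1) fun Q hQ z hz => ?_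
    obtain ⟨y, hyQ, hye⟩ := (Finset.mem_filter.mp hQ).2
    rw [mem_ball] at hye ⊢
    linarith [dist_triangle z y e, dist_le_of_mem_gridSquare hz hyQ]

lemma measure_le_mul_measure_skeleton (h : AhlforsRegular A E) (hb : Bornology.IsBounded E)
    (hA : 1 ≤ A) (hs : 0 < s) (hsD : s ≤ Metric.diam E) :
    μH[1] E ≤ ENNReal.ofReal (726 * A) * μH[1] (T.skeleton E) := by
  obtain ⟨ρ, hρ⟩ := hb.subset_ball 0
  calc μH[1] E = μH[1] (E ∩ ball 0 ρ) := by rw [inter_eq_left.mpr hρ]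
    _ ≤ _ := T.measure_le_measure_skeleton h hb hA hs hsD 0 ρ
    _ ≤ _ := by gcongr; exact inter_subset_left

lemma measure_skeleton_inter_ball_le (h : AhlforsRegular A E) (hb : Bornology.IsBounded E)
    (hA : 1 ≤ A) (hs : 0 < s) (hsD : s ≤ Metric.diam E) (x : R2) {r : ℝ} (hr : 0 < r) :
    μH[1] (T.skeleton E ∩ ball x r) ≤ ENNReal.ofReal (43560 * A ^ 2 * r) := by
  classical
  rcases le_total r s with hrs | hsr
  · have hcov : T.skeleton E ∩ ball x r ⊆
        ⋃ Q ∈ nearIndices s x (2 : ℕ), T.edges Q ∩ ball x r := by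
      rintro y ⟨hy, hyx⟩
      obtain ⟨Q, _, hyQ⟩ := mem_iUnion₂.mp hy
      refine mem_iUnion₂.mpr ⟨Q, ?_, hyQ, hyx⟩
      refine mem_nearIndices (n := 1) hs (T.edges_subset Q hyQ) ?_
      rw [mem_ball'] at hyx
      push_cast
      linarith
    refine (measure_le_card_mul_of_subset_biUnion _ hcov
      fun Q _ => T.measure_edges_inter_ball_le Q x hr).trans ?_
    rw [card_nearIndices, ← ENNReal.ofReal_natCast, ← ENNReal.ofReal_mul (by positivity)]
    apply ENNReal.ofReal_le_ofReal
    have hA2 : 1 * r ≤ A ^ 2 * r := by gcongr; exact one_le_pow₀ hA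
    push_cast
    linarith
  · have hfin := finite_indices hs hb
    set S := hfin.toFinset.filter fun Q => (T.edges Q ∩ ball x r).Nonempty
    have hcov : T.skeleton E ∩ ball x r ⊆ ⋃ Q ∈ S, T.edges Q := by
      rintro y ⟨hy, hyx⟩
      obtain ⟨Q, hQ, hyQ⟩ := mem_iUnion₂.mp hy
      exact mem_iUnion₂.mpr
        ⟨Q, Finset.mem_filter.mpr ⟨hfin.mem_toFinset.mpr hQ, y, hyQ, hyx⟩, hyQ⟩
    calc μH[1] (T.skeleton E ∩ ball x r) ≤ S.card * ENNReal.ofReal (2 * s) :=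
          measure_le_card_mul_of_subset_biUnion _ hcov fun Q _ => T.measure_edges_le hs Q
      _ = ENNReal.ofReal 2 * ENNReal.ofReal (S.card * s) := by
          rw [← ENNReal.ofReal_natCast, ← ENNReal.ofReal_mul (by positivity),
            ← ENNReal.ofReal_mul (by positivity)]
          congr 1
          ring
      _ ≤ ENNReal.ofReal 2 * (ENNReal.ofReal (18 * A) * μH[1] (E ∩ ball x (5 * r))) := by
          gcongr
          refine h.card_mul_le hb hA hs hsD _ _ fun Q hQ => ?_
          obtain ⟨hQ, y, hyQ, hyx⟩ := Finset.mem_filter.mp hQ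
          obtain ⟨p, hp⟩ := hfin.mem_toFinset.mp hQ
          refine ⟨p, hp, ball_subset_ball' ?_⟩
          rw [mem_ball] at hyx
          linarith [dist_triangle p y x,
            dist_le_of_mem_gridSquare hp.1 (T.edges_subset Q hyQ)]
      _ ≤ ENNReal.ofReal 2 * (ENNReal.ofReal (18 * A) * ENNReal.ofReal (242 * A * (5 * r))) := by
          gcongr
          exact h.measure_inter_ball_le hb hA (hs.trans_le hsD) x (by positivity)
      _ = ENNReal.ofReal (43560 * A ^ 2 * r) := by
          rw [← ENNReal.ofReal_mul (by positivity), ← ENNReal.ofReal_mul (by positivity)]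
          congr 1
          ring

lemma le_measure_skeleton_inter_ball (h : AhlforsRegular A E) (hb : Bornology.IsBounded E)
    (hA : 1 ≤ A) (hs : 0 < s) (hsD : s ≤ Metric.diam E) {x : R2} (hx : x ∈ T.skeleton E)
    {r : ℝ} (hr : 0 < r) (hrD : r < 5 * Metric.diam E) :
    ENNReal.ofReal ((43560 * A ^ 2)⁻¹ * r) ≤ μH[1] (T.skeleton E ∩ ball x r) := by
  rcases le_total r (16 * s) with hrs | hsr
  · obtain ⟨Q, hQ, hxQ⟩ := mem_iUnion₂.mp hx
    calc ENNReal.ofReal ((43560 * A ^ 2)⁻¹ * r) ≤ ENNReal.ofReal (r / 16 / 2) := by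
          apply ENNReal.ofReal_le_ofReal
          have : (43560 * A ^ 2)⁻¹ ≤ (32 : ℝ)⁻¹ := by
            gcongr
            nlinarith
          nlinarith
      _ ≤ μH[1] (T.edges Q ∩ ball x (r / 16)) :=
          T.le_measure_edges_inter_ball hxQ (by positivity) (by linarith)
      _ ≤ _ := by
          gcongr
          · exact T.edges_subset_skeleton hQ
          · linarith
  · obtain ⟨e, he, hxe⟩ := T.exists_dist_le_of_mem_skeleton hx
    have hlow : ENNReal.ofReal (A⁻¹ * (r / 8)) ≤
        ENNReal.ofReal (726 * A) * μH[1] (T.skeleton E ∩ ball x r) := by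
      refine (h.lower hb he (by positivity) (by linarith)).trans
        ((T.measure_le_measure_skeleton h hb hA hs hsD e (r / 8)).trans ?_)
      gcongr
      apply ball_subset_ball'
      rw [dist_comm]
      linarith
    have hA0 : A ≠ 0 := by positivity
    calc ENNReal.ofReal ((43560 * A ^ 2)⁻¹ * r)
        ≤ ENNReal.ofReal ((726 * A)⁻¹ * (A⁻¹ * (r / 8))) := by
          apply ENNReal.ofReal_le_ofReal
          have h1 : (726 * A)⁻¹ * (A⁻¹ * (r / 8)) = (5808 * A ^ 2)⁻¹ * r := by
            field_simp
            norm_num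
          rw [h1]
          gcongr
          norm_num
      _ = (ENNReal.ofReal (726 * A))⁻¹ * ENNReal.ofReal (A⁻¹ * (r / 8)) := by
          rw [ENNReal.ofReal_mul (by positivity), ENNReal.ofReal_inv_of_pos (by positivity)]
      _ ≤ (ENNReal.ofReal (726 * A))⁻¹ *
            (ENNReal.ofReal (726 * A) * μH[1] (T.skeleton E ∩ ball x r)) := by gcongr
      _ = _ := by
          have : 0 < 726 * A := by positivity
          rw [← mul_assoc, ENNReal.inv_mul_cancel (by simpa using this) ENNReal.ofReal_ne_top,
            one_mul]

theorem regularity (h : AhlforsRegular A E) (hb : Bornology.IsBounded E) (hA : 1 ≤ A)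
    (hs : 0 < s) (hsD : s ≤ Metric.diam E) :
    AhlforsRegular (43560 * A ^ 2) (T.skeleton E) ∧
      ENNReal.ofReal ((43560 : ℝ)⁻¹ * A⁻¹) * μH[1] E ≤ μH[1] (T.skeleton E) ∧
      μH[1] (T.skeleton E) ≤ ENNReal.ofReal (43560 * A) * μH[1] E := by
  refine ⟨⟨T.isClosed_skeleton hs hb, fun x hx r hr hrD => ⟨?_, ?_⟩⟩, ?_, ?_⟩
  · refine T.le_measure_skeleton_inter_ball h hb hA hs hsD hx hr ?_
    exact (ENNReal.ofReal_lt_ofReal_iff_of_nonneg hr.le).mp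
      (hrD.trans_le (T.ediam_skeleton_le hb hsD))
  · exact T.measure_skeleton_inter_ball_le h hb hA hs hsD x hr
  · have hpos : 0 < 43560 * A := by positivity
    rw [← mul_inv, ENNReal.ofReal_inv_of_pos hpos]
    rw [ENNReal.inv_mul_le_iff (by simpa using hpos) ENNReal.ofReal_ne_top]
    refine (T.measure_le_mul_measure_skeleton h hb hA hs hsD).trans ?_
    gcongr
    norm_num
  · refine (T.measure_skeleton_le h hb hA hs hsD).trans ?_
    gcongr
    norm_num

end EdgePairs

lemma isometry_horizontal (c : ℝ) : Isometry fun t : ℝ => (!₂[t, c] : R2) := by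
  refine Isometry.of_dist_eq fun a b => ?_
  simp [EuclideanSpace.dist_eq, Real.dist_eq, Real.sqrt_sq_eq_abs]

lemma isometry_vertical (c : ℝ) : Isometry fun t : ℝ => (!₂[c, t] : R2) := by
  refine Isometry.of_dist_eq fun a b => ?_
  simp [EuclideanSpace.dist_eq, Real.dist_eq, Real.sqrt_sq_eq_abs]

/-- The bottom and top sides of the squares of the grid of mesh `s`. -/
def horizontalEdges (s : ℝ) (hs : 0 < s) : EdgePairs s where
  first Q t := !₂[t, Q.2 * s]
  second Q t := !₂[t, (Q.2 + 1) * s]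
  start Q := Q.1 * s
  isometry_first _ := isometry_horizontal _
  isometry_second _ := isometry_horizontal _
  first_Icc_subset := by
    rintro Q _ ⟨t, ht, rfl⟩
    simp only [gridSquare, mem_Icc] at ht ⊢
    constructor <;> constructor <;> simp <;> linarith
  second_Icc_subset := by
    rintro Q _ ⟨t, ht, rfl⟩
    simp only [gridSquare, mem_Icc] at ht ⊢
    constructor <;> constructor <;> simp <;> linarith
  first_Ico_subset := by
    rintro Q _ ⟨t, ht, rfl⟩
    simp only [mem_Ico] at ht
    rw [mem_gridCell_iff hs]
    constructor <;> constructor <;> simp <;> linarith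

/-- The left and right sides of the squares of the grid of mesh `s`. -/
def verticalEdges (s : ℝ) (hs : 0 < s) : EdgePairs s where
  first Q t := !₂[Q.1 * s, t]
  second Q t := !₂[(Q.1 + 1) * s, t]
  start Q := Q.2 * s
  isometry_first _ := isometry_vertical _
  isometry_second _ := isometry_vertical _
  first_Icc_subset := by
    rintro Q _ ⟨t, ht, rfl⟩
    simp only [gridSquare, mem_Icc] at ht ⊢
    constructor <;> constructor <;> simp <;> linarith
  second_Icc_subset := by
    rintro Q _ ⟨t, ht, rfl⟩
    simp only [gridSquare, mem_Icc] at ht ⊢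
    constructor <;> constructor <;> simp <;> linarith
  first_Ico_subset := by
    rintro Q _ ⟨t, ht, rfl⟩
    simp only [mem_Ico] at ht
    rw [mem_gridCell_iff hs]
    constructor <;> constructor <;> simp <;> linarith

lemma edges_horizontalEdges {s : ℝ} (hs : 0 < s) (Q : ℤ × ℤ) :
    (horizontalEdges s hs).edges Q =
      {x ∈ gridSquare s Q | x 1 = Q.2 * s ∨ x 1 = (Q.2 + 1) * s} := by
  ext x
  constructor
  · intro hx
    refine ⟨EdgePairs.edges_subset _ Q hx, ?_⟩
    rcases hx with ⟨t, _, rfl⟩ | ⟨t, _, rfl⟩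
    · exact Or.inl rfl
    · exact Or.inr rfl
  · rintro ⟨⟨⟨h1, h2⟩, _⟩, h | h⟩
    · refine Or.inl ⟨x 0, ⟨h1, h2.trans_eq (add_one_mul _ _)⟩, ?_⟩
      ext i
      fin_cases i <;> simp [horizontalEdges, h]
    · refine Or.inr ⟨x 0, ⟨h1, h2.trans_eq (add_one_mul _ _)⟩, ?_⟩
      ext i
      fin_cases i <;> simp [horizontalEdges, h]

lemma edges_verticalEdges {s : ℝ} (hs : 0 < s) (Q : ℤ × ℤ) :
    (verticalEdges s hs).edges Q =
      {x ∈ gridSquare s Q | x 0 = Q.1 * s ∨ x 0 = (Q.1 + 1) * s} := by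
  ext x
  constructor
  · intro hx
    refine ⟨EdgePairs.edges_subset _ Q hx, ?_⟩
    rcases hx with ⟨t, _, rfl⟩ | ⟨t, _, rfl⟩
    · exact Or.inl rfl
    · exact Or.inr rfl
  · rintro ⟨⟨_, h1, h2⟩, h | h⟩
    · refine Or.inl ⟨x 1, ⟨h1, h2.trans_eq (add_one_mul _ _)⟩, ?_⟩
      ext i
      fin_cases i <;> simp [verticalEdges, h]
    · refine Or.inr ⟨x 1, ⟨h1, h2.trans_eq (add_one_mul _ _)⟩, ?_⟩
      ext i
      fin_cases i <;> simp [verticalEdges, h]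

lemma isBounded_unitSquare :
    Bornology.IsBounded {x : R2 | x 0 ∈ Set.Icc (0 : ℝ) 1 ∧ x 1 ∈ Set.Icc (0 : ℝ) 1} := by
  refine Metric.isBounded_iff.mpr ⟨2 * 1, fun x hx y hy => ?_⟩
  exact dist_le_of_mem_gridSquare (Q := 0) (by simpa [gridSquare] using hx)
    (by simpa [gridSquare] using hy)

/-- the union of one pair of parallel sides of the dyadic squares meeting an
Ahlfors regular set is Ahlfors regular with comparable length. -/
theorem statement18 :
    ∃ C : ℝ, 1 ≤ C ∧
      ∀ (A : ℝ) (E : Set R2) (k : ℕ) (F : Set R2),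
        1 ≤ A →
        E ⊆ {x : R2 | x 0 ∈ Set.Icc (0:ℝ) 1 ∧ x 1 ∈ Set.Icc (0:ℝ) 1} →
        AhlforsRegular A E →
        (2:ℝ)^(-(k:ℤ)) ≤ Metric.diam E →
        (F = ⋃ (m : ℤ) (n : ℤ) (_ : (dySq k m n ∩ E).Nonempty),
              {x ∈ dySq k m n |
                x 1 = (n : ℝ) * (2:ℝ)^(-(k:ℤ)) ∨ x 1 = ((n : ℝ)+1) * (2:ℝ)^(-(k:ℤ))} ∨
         F = ⋃ (m : ℤ) (n : ℤ) (_ : (dySq k m n ∩ E).Nonempty),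
              {x ∈ dySq k m n |
                x 0 = (m : ℝ) * (2:ℝ)^(-(k:ℤ)) ∨ x 0 = ((m : ℝ)+1) * (2:ℝ)^(-(k:ℤ))}) →
        AhlforsRegular (C * A^2) F ∧
        ENNReal.ofReal (C⁻¹ * A⁻¹) * μH[1] E ≤ μH[1] F ∧
        μH[1] F ≤ ENNReal.ofReal (C * A) * μH[1] E := by
  refine ⟨43560, by norm_num, fun A E k F hA hE h hk hF => ?_⟩
  have hb := isBounded_unitSquare.subset hE
  have hs : (0 : ℝ) < (2 : ℝ) ^ (-(k : ℤ)) := by positivity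
  rcases hF with rfl | rfl
  · convert (horizontalEdges _ hs).regularity h hb hA hs hk using 0
    simp only [EdgePairs.skeleton, edges_horizontalEdges, iUnion_prod']
    rfl
  · convert (verticalEdges _ hs).regularity h hb hA hs hk using 0
    simp only [EdgePairs.skeleton, edges_verticalEdges, iUnion_prod']
    rfl

end
end

section
/- Let c ∈ (0,1] and let E ⊂ ℝ² be a set satisfying the lower content regularity condition ℋ¹_∞(E ∩ B(x,r)) ≥ c·r for all x ∈ E and 0 < r < diam(E). Then there is a constant C = C(c) such that for every set Γ ⊂ ℝ² and every 0 < δ < diam(E), ℋ¹_∞(E ∩ Γ(3δ)) ≥ C⁻¹·ℋ¹_∞(E(δ) ∩ Γ). -/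
open MeasureTheory Metric Set
open scoped ENNReal NNReal

noncomputable section

/-- The Hausdorff content as an outer measure. -/
def hContentOuter (X : Type*) [EMetricSpace X] : OuterMeasure X :=
  OuterMeasure.ofFunction ediam ediam_empty

theorem hContentOuter_apply {X : Type*} [EMetricSpace X] (s : Set X) :
    hContentOuter X s = hContent s :=
  OuterMeasure.ofFunction_apply _ _ s

theorem hContentOuter_le_ediam {X : Type*} [EMetricSpace X] (s : Set X) :
    hContentOuter X s ≤ ediam s :=
  OuterMeasure.ofFunction_le s

/-- A sum over a family of pairwise disjoint index sets is at most the full sum. -/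
theorem tsum_tsum_le_of_pairwiseDisjoint {ι κ : Type*} {u : Set ι} {A : ι → Set κ}
    (hA : u.PairwiseDisjoint A) (f : κ → ℝ≥0∞) :
    ∑' i : u, ∑' n : A i, f n ≤ ∑' n, f n := by
  rw [← ENNReal.tsum_sigma (fun (i : u) (n : A i) => f n)]
  refine ENNReal.tsum_comp_le_tsum_of_injective
    (f := fun p : Σ i : u, A i => (p.2 : κ)) ?_ f
  rintro ⟨i, n, hn⟩ ⟨j, m, hm⟩ (rfl : n = m)
  obtain rfl : i = j := Subtype.ext <| by
    by_contra hij
    exact (hA i.2 j.2 hij).le_bot ⟨hn, hm⟩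
  rfl

/-- Given a cover `t` of `S`, points whose `δ`-ball meets `E` only inside `S` and only meets
members of `t` of diameter less than `δ` lie within `4δ` of a countable set of controlled cardinality. -/
theorem exists_net_of_small_cover {X : Type*} [MetricSpace X] {E S B : Set X} {c δ : ℝ}
    (hc : 0 < c) (hδ : 0 < δ)
    (hE : ∀ x ∈ B, ENNReal.ofReal (c * δ) ≤ hContent (E ∩ ball x δ))
    (hBS : ∀ x ∈ B, E ∩ ball x δ ⊆ S) {t : ℕ → Set X} (ht : S ⊆ ⋃ n, t n)
    (hsmall : ∀ x ∈ B, ∀ n, (t n ∩ ball x δ).Nonempty → ediam (t n) < ENNReal.ofReal δ)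
    (hfin : ∑' n, ediam (t n) ≠ ∞) :
    ∃ u : Set X, u.Countable ∧ (∀ x ∈ B, ∃ y ∈ u, dist x y < 4 * δ) ∧
      ∑' _ : u, ENNReal.ofReal (c * δ) ≤ ∑' n, ediam (t n) := by
  obtain ⟨u, huB, hdisj, hcov⟩ := Vitali.exists_disjoint_subfamily_covering_enlargement
    (fun x : X => ball x (2 * δ)) B (fun _ => δ) 2 one_lt_two (fun _ _ => hδ.le) δ
    (fun _ _ => le_rfl) (fun x _ => ⟨x, mem_ball_self (by positivity)⟩)
  let A : X → Set ℕ := fun x => {n | (t n ∩ ball x δ).Nonempty}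
  have hA : u.PairwiseDisjoint A := by
    intro x hx y hy hxy
    refine Set.disjoint_left.2 ?_
    rintro n ⟨p, hpt, hpx⟩ ⟨q, hqt, hqy⟩
    have hpq : dist p q < δ := by
      rw [← edist_lt_ofReal]
      exact (edist_le_ediam_of_mem hpt hqt).trans_lt (hsmall x (huB hx) n ⟨p, hpt, hpx⟩)
    refine (hdisj hx hy hxy).le_bot (show p ∈ ball x (2 * δ) ∩ ball y (2 * δ) from ⟨?_, ?_⟩)
    · rw [mem_ball] at *
      linarith
    · rw [mem_ball] at *
      linarith [dist_triangle p q y]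
  have hsum : ∑' _ : u, ENNReal.ofReal (c * δ) ≤ ∑' n, ediam (t n) := by
    refine le_trans (ENNReal.tsum_le_tsum fun x => ?_)
      (tsum_tsum_le_of_pairwiseDisjoint hA fun n => ediam (t n))
    calc ENNReal.ofReal (c * δ) ≤ hContentOuter X (E ∩ ball x δ) := by
          rw [hContentOuter_apply]
          exact hE x (huB x.2)
      _ ≤ hContentOuter X (⋃ n ∈ A x, t n) := by
          refine measure_mono fun z hz => ?_
          obtain ⟨n, hn⟩ := mem_iUnion.1 (ht (hBS x (huB x.2) hz))
          exact mem_biUnion (show n ∈ A x from ⟨z, hn, hz.2⟩) hn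
      _ ≤ ∑' n : A x, hContentOuter X (t n) := measure_biUnion_le _ (to_countable _) _
      _ ≤ _ := ENNReal.tsum_le_tsum fun n => hContentOuter_le_ediam _
  refine ⟨u, ?_, fun x hx => ?_, hsum⟩
  · have : Finite u := by
      by_contra hinf
      rw [not_finite_iff_infinite] at hinf
      refine hfin (top_le_iff.1 (le_trans (le_of_eq ?_) hsum))
      rw [ENNReal.tsum_const_eq_top_of_ne_zero]
      exact (ENNReal.ofReal_pos.2 (by positivity)).ne'
    exact (Set.toFinite u).countable
  · obtain ⟨y, hy, ⟨z, hzx, hzy⟩, -⟩ := hcov x hx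
    refine ⟨y, hy, ?_⟩
    rw [mem_ball] at hzx hzy
    linarith [dist_triangle_left x y z]

theorem hContent_cthickening_inter_le {X : Type*} [MetricSpace X] {E Γ : Set X} {c δ : ℝ}
    (hc : 0 < c) (hδ : 0 < δ)
    (hE : ∀ x ∈ E, ENNReal.ofReal (c * δ) ≤ hContent (E ∩ ball x δ)) :
    hContent (cthickening δ E ∩ Γ) ≤
      ENNReal.ofReal (7 + 12 / c) * hContent (E ∩ cthickening (3 * δ) Γ) := by
  have hC : ENNReal.ofReal (7 + 12 / c) ≠ 0 := (ENNReal.ofReal_pos.2 (by positivity)).ne'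
  rw [← ENNReal.inv_mul_le_iff hC ENNReal.ofReal_ne_top]
  refine le_iInf₂ fun t ht => ?_
  change _ ≤ ∑' n, ediam (t n)
  rw [ENNReal.inv_mul_le_iff hC ENNReal.ofReal_ne_top]
  by_cases hfin : ∑' n, ediam (t n) = ∞
  · rw [hfin, ENNReal.mul_top hC]
    exact le_top
  let B : Set X := {x ∈ E | (∃ y ∈ Γ, dist y x < 2 * δ) ∧
    ∀ n, (t n ∩ ball x δ).Nonempty → ediam (t n) < ENNReal.ofReal δ}
  obtain ⟨u, hu, hBu, hsum⟩ := exists_net_of_small_cover (B := B)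
    (S := E ∩ cthickening (3 * δ) Γ) hc hδ (fun x hx => hE x hx.1)
    (fun x hx z hz => ⟨hz.1, by
      obtain ⟨y, hy, hyx⟩ := hx.2.1
      refine mem_cthickening_of_dist_le z y _ _ hy ?_
      linarith [dist_triangle_right z y x, mem_ball.1 hz.2]⟩) ht (fun x hx => hx.2.2) hfin
  let L : ℕ → Set X := fun n =>
    {y | ENNReal.ofReal δ ≤ ediam (t n) ∧ y ∈ thickening (3 * δ) (t n)}
  have hL : ∀ n, ediam (L n) ≤ ENNReal.ofReal 7 * ediam (t n) := by
    intro n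
    by_cases hn : ENNReal.ofReal δ ≤ ediam (t n)
    · have h3 : ((3 * δ).toNNReal : ℝ) = 3 * δ := Real.coe_toNNReal _ (by positivity)
      calc ediam (L n) ≤ ediam (thickening (3 * δ).toNNReal (t n)) :=
            ediam_mono fun y hy => by rw [h3]; exact hy.2
        _ ≤ ediam (t n) + 2 * ENNReal.ofReal (3 * δ) := ediam_thickening_le _
        _ = ediam (t n) + 6 * ENNReal.ofReal δ := by
            rw [ENNReal.ofReal_mul (by norm_num), ENNReal.ofReal_ofNat, ← mul_assoc]
            norm_num
        _ ≤ ediam (t n) + 6 * ediam (t n) := by gcongr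
        _ = ENNReal.ofReal 7 * ediam (t n) := by
            rw [ENNReal.ofReal_ofNat]
            ring
    · have : L n = ∅ := eq_empty_of_forall_notMem fun y hy => hn hy.1
      simp [this]
  have hcover : cthickening δ E ∩ Γ ⊆ (⋃ n, L n) ∪ ⋃ x ∈ u, ball x (6 * δ) := by
    rintro y ⟨hyE, hyΓ⟩
    obtain ⟨x, hxE, hyx⟩ := infEDist_lt_iff.1 <| (mem_cthickening_iff.1 hyE).trans_lt <|
      (ENNReal.ofReal_lt_ofReal_iff (q := 2 * δ) (by positivity)).2 (by linarith)
    rw [edist_lt_ofReal] at hyx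
    by_cases hx : x ∈ B
    · right
      obtain ⟨z, hz, hxz⟩ := hBu x hx
      refine mem_biUnion hz ?_
      rw [mem_ball]
      linarith [dist_triangle y x z]
    · left
      obtain ⟨n, ⟨z, hzt, hzx⟩, hn⟩ : ∃ n, (t n ∩ ball x δ).Nonempty ∧
          ENNReal.ofReal δ ≤ ediam (t n) := by
        by_contra! h
        exact hx ⟨hxE, ⟨y, hyΓ, hyx⟩, h⟩
      refine mem_iUnion.2 ⟨n, hn, mem_thickening_iff.2 ⟨z, hzt, ?_⟩⟩
      linarith [dist_triangle_right y z x, mem_ball.1 hzx]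
  have hball : ∀ x : X, ediam (ball x (6 * δ)) ≤
      ENNReal.ofReal (12 / c) * ENNReal.ofReal (c * δ) := by
    intro x
    rw [← eball_ofReal, ← ENNReal.ofReal_mul (by positivity)]
    refine ediam_eball_le.trans_eq ?_
    rw [← ENNReal.ofReal_ofNat, ← ENNReal.ofReal_mul (by norm_num)]
    congr 1
    field_simp
    norm_num
  calc hContent (cthickening δ E ∩ Γ)
      = hContentOuter X (cthickening δ E ∩ Γ) := (hContentOuter_apply _).symm
    _ ≤ hContentOuter X ((⋃ n, L n) ∪ ⋃ x ∈ u, ball x (6 * δ)) := measure_mono hcover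
    _ ≤ hContentOuter X (⋃ n, L n) + hContentOuter X (⋃ x ∈ u, ball x (6 * δ)) :=
        measure_union_le _ _
    _ ≤ ∑' n, hContentOuter X (L n) + ∑' x : u, hContentOuter X (ball (x : X) (6 * δ)) :=
        add_le_add (measure_iUnion_le _) (measure_biUnion_le _ hu _)
    _ ≤ ∑' n, ENNReal.ofReal 7 * ediam (t n) +
          ∑' _ : u, ENNReal.ofReal (12 / c) * ENNReal.ofReal (c * δ) :=
        add_le_add (ENNReal.tsum_le_tsum fun n => (hContentOuter_le_ediam _).trans (hL n))
          (ENNReal.tsum_le_tsum fun x => (hContentOuter_le_ediam _).trans (hball x))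
    _ ≤ ENNReal.ofReal 7 * ∑' n, ediam (t n) +
          ENNReal.ofReal (12 / c) * ∑' n, ediam (t n) := by
        rw [ENNReal.tsum_mul_left, ENNReal.tsum_mul_left]
        gcongr
    _ = ENNReal.ofReal (7 + 12 / c) * ∑' n, ediam (t n) := by
        rw [ENNReal.ofReal_add (by norm_num) (by positivity), add_mul]

/-- intersections of a lower content regular set with neighborhoods. -/
theorem statement19 (c : ℝ) (hc0 : 0 < c) (hc1 : c ≤ 1) :
    ∃ C : ℝ, 0 < C ∧
      ∀ E : Set R2,
        (∀ x ∈ E, ∀ r : ℝ, 0 < r → ENNReal.ofReal r < EMetric.diam E →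
          ENNReal.ofReal (c * r) ≤ hContent (E ∩ ball x r)) →
        ∀ (Γ : Set R2) (δ : ℝ), 0 < δ → ENNReal.ofReal δ < EMetric.diam E →
          (ENNReal.ofReal C)⁻¹ * hContent (Metric.cthickening δ E ∩ Γ) ≤
            hContent (E ∩ Metric.cthickening (3 * δ) Γ) := by
  refine ⟨7 + 12 / c, by positivity, fun E hE Γ δ hδ hδE => ?_⟩
  rw [ENNReal.inv_mul_le_iff (ENNReal.ofReal_pos.2 (by positivity)).ne' ENNReal.ofReal_ne_top]
  exact hContent_cthickening_inter_le hc0 hδ fun x hx => hE x hx δ hδ hδE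

end
end
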